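/- arXiv:2603.00851 — 11 statements merged into one kernel-verified Lean document; each statement's English description precedes it below -/
import Mathlib

section
/- Let x ∈ ℝ^d with x ≠ 0, let a, γ ∈ ℝ, let R₀ ∈ ℝ^d, and let λ ∈ ℝ with λ > ‖x‖². Then the supremum over r ∈ ℝ^d of (xᵀr − a)² − γ·xᵀr − λ‖r − R₀‖² is finite and equals (λ/(λ − ‖x‖²))·(xᵀR₀ − (2a+γ)/2)² − aγ − γ²/4. -/
open Matrix

noncomputable section

/-- For `x ≠ 0`, `λ > ‖x‖²`, the supremum over `r` of
`(xᵀr − a)² − γ·xᵀr − λ‖r − R₀‖²` is finite and equals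
`(λ/(λ − ‖x‖²))·(xᵀR₀ − (2a+γ)/2)² − aγ − γ²/4`. -/
theorem stmt0 (d : ℕ) (hd : 1 ≤ d) (x R₀ : EuclideanSpace ℝ (Fin d)) (hx : x ≠ 0)
    (a γ lam : ℝ) (hlam : ‖x‖ ^ 2 < lam) :
    IsLUB (Set.range fun r : EuclideanSpace ℝ (Fin d) =>
        (x ⬝ᵥ r - a) ^ 2 - γ * (x ⬝ᵥ r) - lam * ‖r - R₀‖ ^ 2)
      (lam / (lam - ‖x‖ ^ 2) * (x ⬝ᵥ R₀ - (2 * a + γ) / 2) ^ 2 - a * γ - γ ^ 2 / 4) := by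
  have hip : ∀ u v : EuclideanSpace ℝ (Fin d), u ⬝ᵥ v = inner ℝ u v := by
    intro u v
    simp [dotProduct, PiLp.inner_apply, mul_comm]
  have hN : 0 < ‖x‖ ^ 2 := by
    have := norm_pos_iff.mpr hx
    positivity
  have hM : 0 < lam - ‖x‖ ^ 2 := by linarith
  simp only [hip]
  apply IsGreatest.isLUB
  constructor
  · refine ⟨R₀ + ((inner ℝ x R₀ - (2 * a + γ) / 2) / (lam - ‖x‖ ^ 2)) • x, ?_⟩
    simp only [inner_add_right, inner_smul_right, real_inner_self_eq_norm_sq,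
      add_sub_cancel_left, norm_smul, mul_pow, Real.norm_eq_abs, sq_abs]
    generalize (inner ℝ x R₀ : ℝ) = t
    generalize ‖x‖ ^ 2 = N at *
    have := hM.ne'
    field_simp
    ring
  · rintro _ ⟨r, rfl⟩
    have hcs : (inner ℝ x (r - R₀) : ℝ) ^ 2 ≤ ‖x‖ ^ 2 * ‖r - R₀‖ ^ 2 := by
      rw [← mul_pow]
      exact sq_le_sq' (by linarith [neg_le_of_abs_le (abs_real_inner_le_norm x (r - R₀))])
        (real_inner_le_norm x (r - R₀))
    have hr : (inner ℝ x r : ℝ) = inner ℝ x R₀ + inner ℝ x (r - R₀) := by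
      rw [inner_sub_right]; ring
    simp only [hr]
    generalize (inner ℝ x (r - R₀) : ℝ) = s at *
    generalize (inner ℝ x R₀ : ℝ) = t at *
    generalize ‖x‖ ^ 2 = N at *
    generalize ‖r - R₀‖ ^ 2 = n at *
    obtain ⟨c, hc⟩ : ∃ c, c = t - (2 * a + γ) / 2 := ⟨_, rfl⟩
    have ht : t = c + (2 * a + γ) / 2 := by linarith
    rw [← hc]
    have key : (c + s) ^ 2 - lam * n ≤ lam / (lam - N) * c ^ 2 := by
      rw [div_mul_eq_mul_div, le_div_iff₀ hM]
      have h1 : 0 ≤ lam * (lam - N) * (N * n - s ^ 2) :=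
        mul_nonneg (mul_nonneg (by linarith) hM.le) (by linarith)
      have h2 : N * (((c + s) ^ 2 - lam * n) * (lam - N)) ≤ N * (lam * c ^ 2) := by
        nlinarith [sq_nonneg (N * c - (lam - N) * s)]
      exact le_of_mul_le_mul_left h2 hN
    have : (t + s - a) ^ 2 - γ * (t + s) = (c + s) ^ 2 - a * γ - γ ^ 2 / 4 := by
      rw [ht]; ring
    linarith
end
end

section
/- Let P be a Borel probability measure on ℝ^d with ∫‖R‖² dP(R) < ∞, with mean vector μ_P = ∫R dP(R) and covariance matrix Σ_P. Let x ∈ ℝ^d with x ≠ 0, let a, γ ∈ ℝ, and let λ > ‖x‖². Then ∫ [ sup over r ∈ ℝ^d of ((xᵀr − a)² − γ·xᵀr − λ‖r − R‖²) ] dP(R) = (λ/(λ − ‖x‖²))·(xᵀΣ_P x + (xᵀμ_P − (2a+γ)/2)²) − aγ − γ²/4. -/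
open Matrix MeasureTheory

noncomputable section

theorem aux_sup {d : ℕ} (x : EuclideanSpace ℝ (Fin d)) (hx : x ≠ 0) (a γ lam : ℝ)
    (hlam : ‖x‖ ^ 2 < lam) (R : EuclideanSpace ℝ (Fin d)) :
    (⨆ r : EuclideanSpace ℝ (Fin d),
        ((x ⬝ᵥ r - a) ^ 2 - γ * (x ⬝ᵥ r) - lam * ‖r - R‖ ^ 2))
      = lam / (lam - ‖x‖ ^ 2) * (inner ℝ x R - (2 * a + γ) / 2) ^ 2 - a * γ - γ ^ 2 / 4 := by
  have hdot : ∀ r : EuclideanSpace ℝ (Fin d), x ⬝ᵥ r = inner ℝ x r := by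
    intro r
    simp [PiLp.inner_apply, dotProduct, mul_comm]
  simp only [hdot]
  have hn : 0 < ‖x‖ ^ 2 := by positivity
  have hD : 0 < lam - ‖x‖ ^ 2 := by linarith
  have hg : IsGreatest (Set.range fun r : EuclideanSpace ℝ (Fin d) =>
      ((inner ℝ x r - a) ^ 2 - γ * (inner ℝ x r) - lam * ‖r - R‖ ^ 2))
      (lam / (lam - ‖x‖ ^ 2) * (inner ℝ x R - (2 * a + γ) / 2) ^ 2 - a * γ - γ ^ 2 / 4) := by
    constructor
    · refine ⟨R + ((inner ℝ x R - (2 * a + γ) / 2) / (lam - ‖x‖ ^ 2)) • x, ?_⟩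
      simp only [inner_add_right, inner_smul_right, real_inner_self_eq_norm_sq, add_sub_cancel_left,
        norm_smul, mul_pow, Real.norm_eq_abs, sq_abs]
      generalize ‖x‖ ^ 2 = n at *
      generalize (inner ℝ x R : ℝ) = s at *
      have := hD.ne'
      field_simp
      ring
    · rintro _ ⟨r, rfl⟩
      have hw : (inner ℝ x (r - R) : ℝ) ^ 2 ≤ ‖x‖ ^ 2 * ‖r - R‖ ^ 2 := by
        rw [← mul_pow, ← sq_abs]
        exact pow_le_pow_left₀ (abs_nonneg _) (abs_real_inner_le_norm _ _) 2
      have hr : (inner ℝ x r : ℝ) = inner ℝ x R + inner ℝ x (r - R) := by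
        rw [inner_sub_right]; ring
      simp only [hr]
      generalize (inner ℝ x (r - R) : ℝ) = w at *
      generalize ‖r - R‖ ^ 2 = U at *
      generalize ‖x‖ ^ 2 = n at *
      generalize (inner ℝ x R : ℝ) = s at *
      obtain ⟨p, hp⟩ : ∃ p, p = s - (2 * a + γ) / 2 := ⟨_, rfl⟩
      have hs : s = p + (2 * a + γ) / 2 := by linarith
      subst hs
      have key : (p + w) ^ 2 - lam * U ≤ lam / (lam - n) * p ^ 2 := by
        rw [div_mul_eq_mul_div, le_div_iff₀ hD]
        have h2 : 0 ≤ n * (lam * p ^ 2 - ((p + w) ^ 2 - lam * U) * (lam - n)) := by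
          have h3 : 0 ≤ lam * (lam - n) * (n * U - w ^ 2) :=
            mul_nonneg (mul_nonneg (by linarith) hD.le) (by linarith)
          nlinarith [sq_nonneg (n * p - (lam - n) * w)]
        have := nonneg_of_mul_nonneg_right h2 hn
        linarith
      rw [← hp]
      nlinarith [key]
  exact hg.csSup_eq

theorem aux_quad {d : ℕ} (P : Measure (EuclideanSpace ℝ (Fin d))) [IsProbabilityMeasure P]
    (μP x : EuclideanSpace ℝ (Fin d)) (hL : MemLp (fun R : EuclideanSpace ℝ (Fin d) => R) 2 P)
    (SigP : Matrix (Fin d) (Fin d) ℝ)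
    (hSig : ∀ i j, SigP i j = ∫ R, (R i - μP i) * (R j - μP j) ∂P) :
    x ⬝ᵥ SigP.mulVec x = ∫ R, (inner ℝ x (R - μP)) ^ 2 ∂P := by
  have hc : ∀ i, MemLp (fun R : EuclideanSpace ℝ (Fin d) => R i - μP i) 2 P := by
    intro i
    exact ((EuclideanSpace.proj (𝕜 := ℝ) i).comp_memLp' hL).sub (memLp_const _)
  have hI : ∀ i j, Integrable (fun R : EuclideanSpace ℝ (Fin d) =>
      (R i - μP i) * (R j - μP j)) P := fun i j => (hc i).integrable_mul (hc j)
  have hE : ∀ R : EuclideanSpace ℝ (Fin d), (inner ℝ x (R - μP)) ^ 2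
      = ∑ i, ∑ j, (x i * x j) * ((R i - μP i) * (R j - μP j)) := by
    intro R
    rw [sq, PiLp.inner_apply, Finset.sum_mul_sum]
    refine Finset.sum_congr rfl fun i _ => Finset.sum_congr rfl fun j _ => ?_
    simp
    ring
  simp only [hE]
  rw [integral_finsetSum _ fun i _ => integrable_finsetSum _ fun j _ => (hI i j).const_mul _]
  simp only [dotProduct, mulVec]
  refine Finset.sum_congr rfl fun i _ => ?_
  rw [integral_finsetSum _ fun j _ => (hI i j).const_mul _, Finset.mul_sum]
  refine Finset.sum_congr rfl fun j _ => ?_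
  rw [integral_const_mul, hSig]
  ring

/-- integrating the closed-form inner supremum against a Borel probability
measure `P` with finite second moment gives
`(λ/(λ − ‖x‖²))·(xᵀΣ_P x + (xᵀμ_P − (2a+γ)/2)²) − aγ − γ²/4`. -/
theorem stmt1 (d : ℕ) (hd : 1 ≤ d)
    (P : Measure (EuclideanSpace ℝ (Fin d))) [IsProbabilityMeasure P]
    (hmom : Integrable (fun R => ‖R‖ ^ 2) P)
    (μP : EuclideanSpace ℝ (Fin d)) (hμ : μP = ∫ R, R ∂P)
    (SigP : Matrix (Fin d) (Fin d) ℝ)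
    (hSig : ∀ i j, SigP i j = ∫ R, (R i - μP i) * (R j - μP j) ∂P)
    (x : EuclideanSpace ℝ (Fin d)) (hx : x ≠ 0) (a γ lam : ℝ) (hlam : ‖x‖ ^ 2 < lam) :
    ∫ R, (⨆ r : EuclideanSpace ℝ (Fin d),
        ((x ⬝ᵥ r - a) ^ 2 - γ * (x ⬝ᵥ r) - lam * ‖r - R‖ ^ 2)) ∂P
      = lam / (lam - ‖x‖ ^ 2) * (x ⬝ᵥ SigP.mulVec x + (x ⬝ᵥ μP - (2 * a + γ) / 2) ^ 2)
        - a * γ - γ ^ 2 / 4 := by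
  have hL : MemLp (fun R : EuclideanSpace ℝ (Fin d) => R) 2 P :=
    (memLp_two_iff_integrable_sq_norm aestronglyMeasurable_id).2 hmom
  have hq := aux_quad P μP x hL SigP hSig
  have hdot : x ⬝ᵥ μP = inner ℝ x μP := by
    simp [PiLp.inner_apply, dotProduct, mul_comm]
  simp only [aux_sup x hx a γ lam hlam]
  rw [hq, hdot]
  have hi : Integrable (fun R : EuclideanSpace ℝ (Fin d) => R) P := hL.integrable (by norm_num)
  have hm : MemLp (fun R : EuclideanSpace ℝ (Fin d) => (inner ℝ x (R - μP) : ℝ)) 2 P :=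
    (innerSL ℝ x).comp_memLp' (hL.sub (memLp_const μP))
  have h1 : Integrable (fun R : EuclideanSpace ℝ (Fin d) => (inner ℝ x (R - μP) : ℝ)) P :=
    hm.integrable (by norm_num)
  have h2 := hm.integrable_sq
  have h0 : ∫ R, (inner ℝ x (R - μP) : ℝ) ∂P = 0 := by
    rw [integral_inner (f := fun R => R - μP) (hi.sub (integrable_const _)), integral_sub hi (integrable_const _), ← hμ]
    simp
  have hE : ∀ R : EuclideanSpace ℝ (Fin d),
      lam / (lam - ‖x‖ ^ 2) * (inner ℝ x R - (2 * a + γ) / 2) ^ 2 - a * γ - γ ^ 2 / 4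
      = lam / (lam - ‖x‖ ^ 2) * (inner ℝ x (R - μP)) ^ 2
        + (lam / (lam - ‖x‖ ^ 2) * (2 * (inner ℝ x μP - (2 * a + γ) / 2))) * inner ℝ x (R - μP)
        + (lam / (lam - ‖x‖ ^ 2) * (inner ℝ x μP - (2 * a + γ) / 2) ^ 2 - a * γ - γ ^ 2 / 4) := by
    intro R
    rw [inner_sub_right]
    ring
  rw [integral_congr_ae (Filter.Eventually.of_forall hE)]
  rw [integral_add (by exact (h2.const_mul _).add (h1.const_mul _)) (integrable_const _),
    integral_add (h2.const_mul _) (h1.const_mul _), integral_const_mul, integral_const_mul, h0]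
  simp
  ring
end
end

section
/- For every q ∈ [q₀−ε, q₀+ε], the function (x,a) ↦ h(q,x,a) is ((1−q)λ_M)-strongly convex on Δ × I; that is, the function (x,a) ↦ h(q,x,a) − ((1−q)λ_M/2)·‖(x,a)‖² is convex on Δ × I. -/
open Matrix

noncomputable section

/-- `ℝ^d` with the Euclidean inner product and norm. -/
abbrev E (d : ℕ) := EuclideanSpace ℝ (Fin d)

/-- `ℝ^d × ℝ` equipped with the Euclidean (`L²`) product norm. -/
abbrev Pair (d : ℕ) := WithLp 2 (E d × ℝ)

/-- the standard simplex `Δ`. -/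
def simplexSet (d : ℕ) : Set (E d) := {x | (∀ i, 0 ≤ x i) ∧ ∑ i, x i = 1}

/-- `S(x,a) = sqrt(xᵀΣ_S x + (xᵀμ_S − (2a+γ)/2)²)`. -/
def Sfn (d : ℕ) (SigS : Matrix (Fin d) (Fin d) ℝ) (μS : E d) (γ : ℝ)
    (x : E d) (a : ℝ) : ℝ :=
  Real.sqrt (x ⬝ᵥ SigS.mulVec x + (x ⬝ᵥ μS - (2 * a + γ) / 2) ^ 2)

/-- `V(q,x,a) = (r(q)‖x‖ + S(x,a))² − aγ − γ²/4`. -/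
def Vfn (d : ℕ) (SigS : Matrix (Fin d) (Fin d) ℝ) (μS : E d) (γ : ℝ) (r : ℝ → ℝ)
    (q : ℝ) (x : E d) (a : ℝ) : ℝ :=
  (r q * ‖x‖ + Sfn d SigS μS γ x a) ^ 2 - a * γ - γ ^ 2 / 4

/-- `e_N(x,a) = xᵀΣ_N x + (xᵀμ_N − a)² − γ·xᵀμ_N`. -/
def eNfn (d : ℕ) (SigN : Matrix (Fin d) (Fin d) ℝ) (μN : E d) (γ : ℝ)
    (x : E d) (a : ℝ) : ℝ :=
  x ⬝ᵥ SigN.mulVec x + (x ⬝ᵥ μN - a) ^ 2 - γ * (x ⬝ᵥ μN)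

/-- `h(q,x,a) = (1−q)·e_N(x,a) + q·V(q,x,a)`. -/
def hfn (d : ℕ) (SigN SigS : Matrix (Fin d) (Fin d) ℝ) (μN μS : E d) (γ : ℝ) (r : ℝ → ℝ)
    (q : ℝ) (x : E d) (a : ℝ) : ℝ :=
  (1 - q) * eNfn d SigN μN γ x a + q * Vfn d SigS μS γ r q x a

/-- `J(x,a) = max_{q ∈ [q₀−ε, q₀+ε]} h(q,x,a)`. -/
def Jfn (d : ℕ) (SigN SigS : Matrix (Fin d) (Fin d) ℝ) (μN μS : E d) (γ : ℝ) (r : ℝ → ℝ)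
    (q₀ ε : ℝ) (x : E d) (a : ℝ) : ℝ :=
  sSup ((fun q => hfn d SigN SigS μN μS γ r q x a) '' Set.Icc (q₀ - ε) (q₀ + ε))

/-- the pair `(x,a)` as an element of the `L²` product space. -/
def mkPair (d : ℕ) (x : E d) (a : ℝ) : Pair d := (WithLp.equiv 2 (E d × ℝ)).symm (x, a)

/-- gradient `∇_{(x,a)} h(q,·,·)` in the joint variable `(x,a)`. -/
def gradh (d : ℕ) (SigN SigS : Matrix (Fin d) (Fin d) ℝ) (μN μS : E d) (γ : ℝ) (r : ℝ → ℝ)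
    (q : ℝ) (pt : Pair d) : Pair d :=
  gradient (fun y : Pair d =>
    hfn d SigN SigS μN μS γ r q (WithLp.equiv 2 (E d × ℝ) y).1
      (WithLp.equiv 2 (E d × ℝ) y).2) pt

/-- `lam` is the smallest eigenvalue of the symmetric matrix `M`, characterized as the
largest constant `t` with `zᵀMz ≥ t‖z‖²` for all `z` (Rayleigh quotient). -/
def IsSmallestEigen {n : Type*} [Fintype n] (M : Matrix n n ℝ) (lam : ℝ) : Prop :=
  IsGreatest {t : ℝ | ∀ z : n → ℝ, t * (z ⬝ᵥ z) ≤ z ⬝ᵥ M.mulVec z} lam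

/-- the `(d+1)×(d+1)` block matrix `M = [[Σ_N + μ_N μ_Nᵀ, −μ_N], [−μ_Nᵀ, 1]]`. -/
def Mblock (d : ℕ) (SigN : Matrix (Fin d) (Fin d) ℝ) (μN : E d) :
    Matrix (Fin d ⊕ Unit) (Fin d ⊕ Unit) ℝ :=
  Matrix.fromBlocks (SigN + vecMulVec μN μN) (fun i (_ : Unit) => -μN i)
    (fun (_ : Unit) j => -μN j) 1

lemma aux_quad_s4 {d : ℕ} (A : Matrix (Fin d) (Fin d) ℝ) (hA : A.IsSymm) (x y : Fin d → ℝ) (s t : ℝ) :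
    (s • x + t • y) ⬝ᵥ A.mulVec (s • x + t • y) =
      s ^ 2 * (x ⬝ᵥ A.mulVec x) + 2 * s * t * (x ⬝ᵥ A.mulVec y) + t ^ 2 * (y ⬝ᵥ A.mulVec y) := by
  have h : y ⬝ᵥ A.mulVec x = x ⬝ᵥ A.mulVec y := by
    rw [Matrix.dotProduct_mulVec, ← Matrix.mulVec_transpose, hA.eq, dotProduct_comm]
  simp only [Matrix.mulVec_add, Matrix.mulVec_smul, dotProduct_add, add_dotProduct,
    dotProduct_smul, smul_dotProduct, smul_eq_mul, h]
  ring

lemma aux_sqrt (P1 P2 B s t : ℝ) (hs : 0 ≤ s) (ht : 0 ≤ t) (h1 : 0 ≤ P1) (h2 : 0 ≤ P2)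
    (h : ∀ τ : ℝ, 0 ≤ P2 * (τ * τ) + 2 * B * τ + P1) :
    √(s ^ 2 * P1 + 2 * s * t * B + t ^ 2 * P2) ≤ s * √P1 + t * √P2 := by
  have hd := discrim_le_zero h
  rw [discrim] at hd
  have hB : B ≤ √P1 * √P2 := by
    rw [← Real.sqrt_mul h1]
    exact Real.le_sqrt_of_sq_le (by nlinarith)
  apply Real.sqrt_le_iff.2
  refine ⟨by positivity, ?_⟩
  have e1 := Real.sq_sqrt h1
  have e2 := Real.sq_sqrt h2
  have := mul_le_mul_of_nonneg_left hB (mul_nonneg hs ht)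
  nlinarith

lemma aux_M {d : ℕ} (SigN : Matrix (Fin d) (Fin d) ℝ) (μN : E d) (x : Fin d → ℝ) (a : ℝ) :
    (Sum.elim x (fun _ : Unit => a)) ⬝ᵥ (Mblock d SigN μN).mulVec (Sum.elim x (fun _ => a)) =
      x ⬝ᵥ SigN.mulVec x + (x ⬝ᵥ μN - a) ^ 2 := by
  have e1 : Matrix.mulVec (m := Fin d) (n := Unit) (fun i (_ : Unit) => -μN i) (fun _ => a)
      = (-a) • (μN : Fin d → ℝ) := by
    ext i; simp [Matrix.mulVec, dotProduct]; ring
  have e2 : Matrix.mulVec (m := Unit) (n := Fin d) (fun (_ : Unit) j => -μN j) x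
      = fun _ => - (x ⬝ᵥ μN) := by
    ext i; simp [Matrix.mulVec, dotProduct, mul_comm]
  have e3 : (vecMulVec μN μN).mulVec x = (x ⬝ᵥ μN) • (μN : Fin d → ℝ) := by
    ext i
    simp only [Matrix.mulVec, dotProduct, vecMulVec_apply, Pi.smul_apply, smul_eq_mul, Finset.sum_mul]
    exact Finset.sum_congr rfl fun j _ => by ring
  have e0 : (Mblock d SigN μN).mulVec (Sum.elim x (fun _ => a)) =
      Sum.elim ((SigN + vecMulVec μN μN).mulVec x + (-a) • (μN : Fin d → ℝ))
        ((fun _ => - (x ⬝ᵥ μN)) + (1 : Matrix Unit Unit ℝ).mulVec (fun _ => a)) := by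
    rw [← e1, ← e2]
    exact Matrix.fromBlocks_mulVec _ _ _ _ _
  rw [e0, sumElim_dotProduct_sumElim, Matrix.add_mulVec, e3, one_mulVec]
  simp only [dotProduct_add, dotProduct_smul, smul_eq_mul]
  have e4 : ∀ u v : ℝ, (fun _ : Unit => u) ⬝ᵥ (fun _ : Unit => v) = u * v := fun u v => by
    simp [dotProduct]
  rw [e4, e4]
  ring

lemma aux_norm {d : ℕ} (x : E d) : ‖x‖ ^ 2 = (x : Fin d → ℝ) ⬝ᵥ x := by
  rw [EuclideanSpace.real_norm_sq_eq]
  simp [dotProduct, sq]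

lemma aux_convex (d : ℕ) : Convex ℝ (simplexSet d) := by
  intro x hx y hy s t hs ht hst
  refine ⟨fun i => ?_, ?_⟩
  · have := hx.1 i
    have := hy.1 i
    simp only [PiLp.add_apply, PiLp.smul_apply, smul_eq_mul]
    positivity
  · simp only [PiLp.add_apply, PiLp.smul_apply, smul_eq_mul, Finset.sum_add_distrib,
      ← Finset.mul_sum, hx.2, hy.2]
    linarith

/-- for every `q ∈ [q₀−ε, q₀+ε]`, `(x,a) ↦ h(q,x,a)` is
`((1−q)λ_M)`-strongly convex on `Δ × I` (Euclidean norm on the pair `(x,a)`). -/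
theorem stmt4 (d : ℕ) (hd : 1 ≤ d)
    (γ : ℝ) (hγ : 0 < γ) (μN μS : E d) (SigN SigS : Matrix (Fin d) (Fin d) ℝ)
    (hSymN : SigN.IsSymm) (hPDN : SigN.PosDef) (hSymS : SigS.IsSymm) (hPDS : SigS.PosDef)
    (r : ℝ → ℝ) (hr : ContDiff ℝ 2 r) (hrpos : ∀ q, 0 ≤ r q)
    (q₀ ε : ℝ) (hε : 0 ≤ ε) (hq1 : 0 < q₀ - ε) (hq2 : q₀ + ε < 1)
    (lo hi : ℝ) (hIo : lo ≤ hi)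
    (lamM : ℝ) (hlamM : IsSmallestEigen (Mblock d SigN μN) lamM) (hlamMpos : 0 < lamM) :
    ∀ q ∈ Set.Icc (q₀ - ε) (q₀ + ε),
      ConvexOn ℝ (simplexSet d ×ˢ Set.Icc lo hi)
        (fun pt : E d × ℝ => hfn d SigN SigS μN μS γ r q pt.1 pt.2
          - (1 - q) * lamM / 2 * (‖pt.1‖ ^ 2 + pt.2 ^ 2)) := by
  intro q hq
  have hq0 : 0 ≤ q := by linarith [hq.1]
  have hq1' : 0 ≤ 1 - q := by linarith [hq.2]
  refine ⟨(aux_convex d).prod (convex_Icc lo hi), ?_⟩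
  rintro ⟨x, a⟩ - ⟨y, b⟩ - s t hs ht hst
  have hS0 : ∀ z : Fin d → ℝ, 0 ≤ z ⬝ᵥ SigS.mulVec z := fun z => by
    simpa using hPDS.posSemidef.dotProduct_mulVec_nonneg z
  have hlin : ∀ (μ : E d) (s t : ℝ), (s • (x : Fin d → ℝ) + t • (y : Fin d → ℝ)) ⬝ᵥ μ
      = s * (x ⬝ᵥ μ) + t * (y ⬝ᵥ μ) := fun μ s t => by
    simp [add_dotProduct, smul_dotProduct]
  have hco : ((s • x + t • y : E d) : Fin d → ℝ) = s • (x : Fin d → ℝ) + t • (y : Fin d → ℝ) := by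
    ext i; simp
  -- convexity of S
  have hS : Sfn d SigS μS γ (s • x + t • y) (s * a + t * b) ≤
      s * Sfn d SigS μS γ x a + t * Sfn d SigS μS γ y b := by
    have key := aux_sqrt (x ⬝ᵥ SigS.mulVec x + (x ⬝ᵥ μS - (2 * a + γ) / 2) ^ 2)
      (y ⬝ᵥ SigS.mulVec y + (y ⬝ᵥ μS - (2 * b + γ) / 2) ^ 2)
      (x ⬝ᵥ SigS.mulVec y + (x ⬝ᵥ μS - (2 * a + γ) / 2) * (y ⬝ᵥ μS - (2 * b + γ) / 2))
      s t hs ht (add_nonneg (hS0 _) (sq_nonneg _)) (add_nonneg (hS0 _) (sq_nonneg _)) (by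
        intro τ
        have h1 := hS0 ((1 : ℝ) • (x : Fin d → ℝ) + τ • (y : Fin d → ℝ))
        rw [aux_quad_s4 _ hSymS] at h1
        nlinarith [sq_nonneg ((x ⬝ᵥ μS - (2 * a + γ) / 2) + τ * (y ⬝ᵥ μS - (2 * b + γ) / 2))])
    unfold Sfn
    refine le_trans (le_of_eq ?_) key
    congr 1
    rw [hco, aux_quad_s4 _ hSymS, hlin]
    have : t = 1 - s := by linarith
    subst this
    ring
  have hV : Vfn d SigS μS γ r q (s • x + t • y) (s * a + t * b) ≤
      s * Vfn d SigS μS γ r q x a + t * Vfn d SigS μS γ r q y b := by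
    have hn : ‖s • x + t • y‖ ≤ s * ‖x‖ + t * ‖y‖ := by
      refine (norm_add_le _ _).trans (le_of_eq ?_)
      rw [norm_smul, norm_smul, Real.norm_of_nonneg hs, Real.norm_of_nonneg ht]
    have hrq := hrpos q
    have hN := add_le_add (mul_le_mul_of_nonneg_left hn hrq) hS
    have h0 : 0 ≤ r q * ‖s • x + t • y‖ + Sfn d SigS μS γ (s • x + t • y) (s * a + t * b) :=
      add_nonneg (by positivity) (Real.sqrt_nonneg _)
    have hsq := pow_le_pow_left₀ h0 hN 2
    unfold Vfn
    have ht' : t = 1 - s := by linarith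
    have := mul_nonneg (mul_nonneg hs ht) (sq_nonneg
      ((r q * ‖x‖ + Sfn d SigS μS γ x a) - (r q * ‖y‖ + Sfn d SigS μS γ y b)))
    generalize Sfn d SigS μS γ x a = S1 at *
    generalize Sfn d SigS μS γ y b = S2 at *
    generalize Sfn d SigS μS γ (s • x + t • y) (s * a + t * b) = S3 at *
    generalize ‖s • x + t • y‖ = n3 at *
    have e : (r q * (s * ‖x‖ + t * ‖y‖) + (s * S1 + t * S2)) ^ 2 +
        s * t * ((r q * ‖x‖ + S1) - (r q * ‖y‖ + S2)) ^ 2 =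
        s * (r q * ‖x‖ + S1) ^ 2 + t * (r q * ‖y‖ + S2) ^ 2 := by
      rw [ht']; ring
    have e' : s * (γ ^ 2 / 4) + t * (γ ^ 2 / 4) = γ ^ 2 / 4 := by rw [ht']; ring
    linarith
  have hE : eNfn d SigN μN γ (s • x + t • y) (s * a + t * b)
        - lamM / 2 * (‖s • x + t • y‖ ^ 2 + (s * a + t * b) ^ 2) ≤
      s * (eNfn d SigN μN γ x a - lamM / 2 * (‖x‖ ^ 2 + a ^ 2)) +
      t * (eNfn d SigN μN γ y b - lamM / 2 * (‖y‖ ^ 2 + b ^ 2)) := by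
    have hM := hlamM.1 (Sum.elim ((1 : ℝ) • (x : Fin d → ℝ) + (-1 : ℝ) • (y : Fin d → ℝ))
      (fun _ => a - b))
    rw [aux_M, sumElim_dotProduct_sumElim, aux_quad_s4 _ hSymN, hlin μN] at hM
    have hI : ∀ s t : ℝ, (s • (x : Fin d → ℝ) + t • (y : Fin d → ℝ)) ⬝ᵥ
        (s • (x : Fin d → ℝ) + t • (y : Fin d → ℝ)) =
        s ^ 2 * (x ⬝ᵥ x) + 2 * s * t * (x ⬝ᵥ y) + t ^ 2 * (y ⬝ᵥ y) := fun s t => by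
      simpa using aux_quad_s4 (1 : Matrix (Fin d) (Fin d) ℝ) Matrix.isSymm_one x y s t
    have hp : 0 ≤ ((1 : ℝ) • (x : Fin d → ℝ) + (-1 : ℝ) • (y : Fin d → ℝ)) ⬝ᵥ
        ((1 : ℝ) • (x : Fin d → ℝ) + (-1 : ℝ) • (y : Fin d → ℝ)) := by
      simpa using dotProduct_star_self_nonneg
        ((1 : ℝ) • (x : Fin d → ℝ) + (-1 : ℝ) • (y : Fin d → ℝ))
    have hu : (fun _ : Unit => a - b) ⬝ᵥ (fun _ : Unit => a - b) = (a - b) ^ 2 := by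
      simp [dotProduct, sq]
    rw [hu] at hM
    have hp2 := mul_nonneg hlamMpos.le (add_nonneg hp (sq_nonneg (a - b)))
    rw [hI] at hM hp2
    simp only [eNfn, aux_norm]
    rw [hco, aux_quad_s4 _ hSymN, hI, hlin μN]
    have ht' : t = 1 - s := by linarith
    have hst0 := mul_nonneg hs ht
    have h1 := mul_le_mul_of_nonneg_left hM hst0
    have h2 := mul_nonneg hst0 hp2
    subst ht'
    linarith
  simp only [Prod.smul_mk, Prod.mk_add_mk, smul_eq_mul, hfn]
  have h1 := mul_le_mul_of_nonneg_left hV hq0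
  have h2 := mul_le_mul_of_nonneg_left hE hq1'
  linarith
end
end

section
/- For every q ∈ ℝ with r(q) ≥ 0, the function (x,a) ↦ (r(q)‖x‖ + S(x,a))² is convex on ℝ^d × ℝ; consequently (x,a) ↦ V(q,x,a) is convex on ℝ^d × ℝ. -/
open Matrix

noncomputable section

lemma Sfn_convex (d : ℕ) (γ : ℝ) (μS : E d)
    (SigS : Matrix (Fin d) (Fin d) ℝ) (hPDS : SigS.PosDef) :
    ConvexOn ℝ Set.univ (fun pt : E d × ℝ => Sfn d SigS μS γ pt.1 pt.2) := by
  obtain ⟨B, hB⟩ : ∃ B : Matrix (Fin d) (Fin d) ℝ, SigS = Bᴴ * B := by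
    open scoped MatrixOrder Matrix.Norms.L2Operator in
    exact CStarAlgebra.nonneg_iff_eq_star_mul_self.mp hPDS.posSemidef.nonneg
  let L : E d × ℝ → WithLp 2 (E d × ℝ) := fun pt =>
    WithLp.toLp 2 (WithLp.toLp 2 (B *ᵥ pt.1), pt.1 ⬝ᵥ μS - (2 * pt.2 + γ) / 2)
  have hS : ∀ pt : E d × ℝ, Sfn d SigS μS γ pt.1 pt.2 = ‖L pt‖ := by
    intro pt
    rw [WithLp.prod_norm_eq_of_L2, Sfn]
    congr 1
    simp only [L, EuclideanSpace.norm_sq_eq, Real.norm_eq_abs, sq_abs]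
    congr 1
    rw [hB, ← Matrix.mulVec_mulVec, Matrix.dotProduct_mulVec, Matrix.conjTranspose_eq_transpose_of_trivial,
      Matrix.vecMul_transpose]
    simp [dotProduct, sq]
  refine ⟨convex_univ, ?_⟩
  intro p _ q _ s t hs ht hst
  simp only [hS]
  have hL : L (s • p + t • q) = s • L p + t • L q := by
    have h1 : B *ᵥ (s • p + t • q).1 = s • (B *ᵥ p.1) + t • (B *ᵥ q.1) := by
      simp [Matrix.mulVec_add, Matrix.mulVec_smul]
    have h2 : (s • p + t • q).1 ⬝ᵥ μS - (2 * (s • p + t • q).2 + γ) / 2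
      = s * (p.1 ⬝ᵥ μS - (2 * p.2 + γ) / 2) + t * (q.1 ⬝ᵥ μS - (2 * q.2 + γ) / 2) := by
      have : t = 1 - s := by linarith
      subst this
      simp [add_dotProduct, smul_dotProduct]
      ring
    simp only [L]
    rw [h1, h2]
    rfl
  rw [hL]
  calc _ ≤ ‖s • L p‖ + ‖t • L q‖ := norm_add_le _ _
    _ = _ := by rw [norm_smul, norm_smul, Real.norm_of_nonneg hs, Real.norm_of_nonneg ht]; rfl

/-- for every `q` with `r(q) ≥ 0`, `(x,a) ↦ (r(q)‖x‖ + S(x,a))²` is convex on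
`ℝ^d × ℝ`; consequently `(x,a) ↦ V(q,x,a)` is convex on `ℝ^d × ℝ`. -/
theorem stmt5 (d : ℕ) (hd : 1 ≤ d) (γ : ℝ) (hγ : 0 < γ) (μS : E d)
    (SigS : Matrix (Fin d) (Fin d) ℝ) (hSymS : SigS.IsSymm) (hPDS : SigS.PosDef)
    (r : ℝ → ℝ) :
    ∀ q : ℝ, 0 ≤ r q →
      ConvexOn ℝ Set.univ
          (fun pt : E d × ℝ => (r q * ‖pt.1‖ + Sfn d SigS μS γ pt.1 pt.2) ^ 2)
        ∧ ConvexOn ℝ Set.univ (fun pt : E d × ℝ => Vfn d SigS μS γ r q pt.1 pt.2) := by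
  intro q hq
  have hS := Sfn_convex d γ μS SigS hPDS
  have hN : ConvexOn ℝ Set.univ (fun pt : E d × ℝ => r q * ‖pt.1‖) := by
    have h := (convexOn_univ_norm (E := E d)).comp_linearMap (LinearMap.fst ℝ (E d) ℝ)
    exact h.smul hq
  have h1 : ConvexOn ℝ Set.univ
      (fun pt : E d × ℝ => (r q * ‖pt.1‖ + Sfn d SigS μS γ pt.1 pt.2) ^ 2) := by
    refine (hN.add hS).pow ?_ 2
    intro pt _
    exact add_nonneg (mul_nonneg hq (norm_nonneg _)) (Real.sqrt_nonneg _)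
  refine ⟨h1, convex_univ, ?_⟩
  intro x _ y _ s t hs ht hst
  have h := h1.2 (Set.mem_univ x) (Set.mem_univ y) hs ht hst
  simp only [Vfn, smul_eq_mul, Prod.snd_add, Prod.smul_snd] at h ⊢
  have e : t = 1 - s := by linarith
  subst e
  linarith
end
end

section
/- Let n ≥ 1, let U ⊆ ℝⁿ be a convex set, let q₁ < q₂ be reals, and let f : ℝ × ℝⁿ → ℝ be twice continuously differentiable on an open set containing [q₁,q₂] × U. Assume there exist α > 0 and K ≥ 0 such that ∂²f/∂q²(q,u) ≤ −α and ‖∇_u(∂f/∂q)(q,u)‖ ≤ K for all (q,u) ∈ [q₁,q₂] × U. For each u ∈ U, the map q ↦ f(q,u) has a unique maximizer q*(u) on [q₁,q₂], and |q*(u₁) − q*(u₂)| ≤ (K/α)·‖u₁ − u₂‖ for all u₁, u₂ ∈ U. -/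
noncomputable section

/-- for `f` twice continuously differentiable on a neighborhood of
`[q₁,q₂] × U` with `∂²f/∂q² ≤ −α < 0` and `‖∇_u ∂f/∂q‖ ≤ K` there, the map
`q ↦ f(q,u)` has a unique maximizer `q*(u)` on `[q₁,q₂]`, and `q*` is `(K/α)`-Lipschitz
on the convex set `U`. -/
theorem stmt7 (n : ℕ) (hn : 1 ≤ n) (U : Set (EuclideanSpace ℝ (Fin n))) (hU : Convex ℝ U)
    (q₁ q₂ : ℝ) (hq : q₁ < q₂) (f : ℝ × EuclideanSpace ℝ (Fin n) → ℝ)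
    (O : Set (ℝ × EuclideanSpace ℝ (Fin n))) (hO : IsOpen O)
    (hsub : Set.Icc q₁ q₂ ×ˢ U ⊆ O) (hf : ContDiffOn ℝ 2 f O)
    (α K : ℝ) (hα : 0 < α) (hK : 0 ≤ K)
    (hconc : ∀ q ∈ Set.Icc q₁ q₂, ∀ u ∈ U, deriv (deriv (fun t => f (t, u))) q ≤ -α)
    (hcross : ∀ q ∈ Set.Icc q₁ q₂, ∀ u ∈ U,
      ‖gradient (fun v => deriv (fun t => f (t, v)) q) u‖ ≤ K) :
    ∃ qstar : EuclideanSpace ℝ (Fin n) → ℝ,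
      (∀ u ∈ U, qstar u ∈ Set.Icc q₁ q₂
        ∧ (∀ t ∈ Set.Icc q₁ q₂, f (t, u) ≤ f (qstar u, u))
        ∧ (∀ t ∈ Set.Icc q₁ q₂, (∀ t' ∈ Set.Icc q₁ q₂, f (t', u) ≤ f (t, u)) → t = qstar u))
      ∧ ∀ u₁ ∈ U, ∀ u₂ ∈ U, |qstar u₁ - qstar u₂| ≤ K / α * ‖u₁ - u₂‖ := by
  have hdf : ∀ p ∈ O, HasDerivAt (fun t => f (t, p.2)) (fderiv ℝ f p (1, 0)) p.1 := by
    intro p hp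
    have h1 : HasFDerivAt f (fderiv ℝ f p) (p.1, p.2) :=
      ((hf.contDiffAt (hO.mem_nhds hp)).differentiableAt (by norm_num)).hasFDerivAt
    have h2 : HasDerivAt (fun t : ℝ => (t, p.2)) ((1 : ℝ), (0 : EuclideanSpace ℝ (Fin n))) p.1 :=
      (hasDerivAt_id p.1).prodMk (hasDerivAt_const p.1 p.2)
    exact h1.comp_hasDerivAt p.1 h2
  have hG : ∀ p ∈ O, DifferentiableAt ℝ
      (fun p : ℝ × EuclideanSpace ℝ (Fin n) => deriv (fun t => f (t, p.2)) p.1) p := by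
    intro p hp
    have h1 : DifferentiableAt ℝ (fderiv ℝ f) p :=
      ((hf.contDiffAt (hO.mem_nhds hp)).fderiv_right (m := 1) (by norm_num)).differentiableAt
        (by norm_num)
    have h2 : DifferentiableAt ℝ (fun p => fderiv ℝ f p (1, 0)) p :=
      h1.clm_apply (differentiableAt_const _)
    refine h2.congr_of_eventuallyEq ?_
    filter_upwards [hO.mem_nhds hp] with p hp
    exact (hdf p hp).deriv
  have hD : ∀ q ∈ Set.Icc q₁ q₂, ∀ u ∈ U, HasDerivAt (fun t => f (t, u))
      (deriv (fun t => f (t, u)) q) q := fun q hq u hu =>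
    (hdf (q, u) (hsub ⟨hq, hu⟩)).differentiableAt.hasDerivAt
  have hGq : ∀ q ∈ Set.Icc q₁ q₂, ∀ u ∈ U,
      DifferentiableAt ℝ (deriv (fun t => f (t, u))) q := by
    intro q hq u hu
    have h := hG (q, u) (hsub ⟨hq, hu⟩)
    have h2 : DifferentiableAt ℝ (fun t : ℝ => (t, u)) q :=
      differentiableAt_id.prodMk (differentiableAt_const u)
    exact DifferentiableAt.comp q h h2
  have hGu : ∀ q ∈ Set.Icc q₁ q₂, ∀ u ∈ U,
      DifferentiableAt ℝ (fun v => deriv (fun t => f (t, v)) q) u := by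
    intro q hq u hu
    have h := hG (q, u) (hsub ⟨hq, hu⟩)
    have h2 : DifferentiableAt ℝ (fun v : EuclideanSpace ℝ (Fin n) => (q, v)) u :=
      (differentiableAt_const q).prodMk differentiableAt_id
    exact DifferentiableAt.comp u h h2
  have hmono : ∀ u ∈ U, ∀ s ∈ Set.Icc q₁ q₂, ∀ t ∈ Set.Icc q₁ q₂, s ≤ t →
      deriv (fun t => f (t, u)) t - deriv (fun t => f (t, u)) s ≤ -α * (t - s) := by
    intro u hu s hs t ht hst
    refine (convex_Icc q₁ q₂).image_sub_le_mul_sub_of_deriv_le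
      (fun q hq => (hGq q hq u hu).continuousAt.continuousWithinAt)
      (fun q hq => (hGq q (interior_subset hq) u hu).differentiableWithinAt)
      (fun q hq => hconc q (interior_subset hq) u hu) s hs t ht hst
  have hlip : ∀ q ∈ Set.Icc q₁ q₂, ∀ u ∈ U, ∀ v ∈ U,
      |deriv (fun t => f (t, v)) q - deriv (fun t => f (t, u)) q| ≤ K * ‖v - u‖ := by
    intro q hq u hu v hv
    refine hU.norm_image_sub_le_of_norm_fderiv_le (𝕜 := ℝ)
      (f := fun v => deriv (fun t => f (t, v)) q)
      (fun x hx => hGu q hq x hx) (fun x hx => ?_) hu hv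
    have := hcross q hq x hx
    rwa [gradient, LinearIsometryEquiv.norm_map] at this
  have hopt : ∀ u ∈ U, ∀ a ∈ Set.Icc q₁ q₂, (∀ t ∈ Set.Icc q₁ q₂, f (t, u) ≤ f (a, u)) →
      ∀ b ∈ Set.Icc q₁ q₂, (b - a) * deriv (fun t => f (t, u)) a ≤ 0 := by
    intro u hu a ha hmax b hb
    have h1 : IsLocalMaxOn (fun t => f (t, u)) (Set.Icc q₁ q₂) a :=
      IsMaxOn.localize (fun t ht => hmax t ht)
    have h2 := h1.hasFDerivWithinAt_nonpos (hD a ha u hu).hasFDerivAt.hasFDerivWithinAt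
      (sub_mem_posTangentConeAt_of_segment_subset ((convex_Icc q₁ q₂).segment_subset ha hb))
    simpa using h2
  have hle : ∀ u ∈ U, ∀ v ∈ U, ∀ a ∈ Set.Icc q₁ q₂, ∀ b ∈ Set.Icc q₁ q₂,
      (∀ t ∈ Set.Icc q₁ q₂, f (t, u) ≤ f (a, u)) →
      (∀ t ∈ Set.Icc q₁ q₂, f (t, v) ≤ f (b, v)) → b - a ≤ K / α * ‖u - v‖ := by
    intro u hu v hv a ha b hb hma hmb
    rcases le_or_gt b a with hab | hab
    · have : 0 ≤ K / α * ‖u - v‖ := by positivity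
      linarith
    have h1 := hopt u hu a ha hma b hb
    have h2 := hopt v hv b hb hmb a ha
    have h3 : deriv (fun t => f (t, u)) a ≤ 0 := by
      by_contra! h; nlinarith [mul_pos (sub_pos.2 hab) h]
    have h4 : 0 ≤ deriv (fun t => f (t, v)) b := by
      by_contra! h; nlinarith [mul_pos (sub_pos.2 hab) (neg_pos.2 h)]
    have h5 := hmono u hu a ha b hb hab.le
    have h6 := (abs_le.1 (hlip b hb v hv u hu)).1
    rw [div_mul_eq_mul_div, le_div_iff₀ hα]
    linarith
  have hex : ∀ u ∈ U, ∃ a ∈ Set.Icc q₁ q₂, ∀ t ∈ Set.Icc q₁ q₂, f (t, u) ≤ f (a, u) := by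
    intro u hu
    exact isCompact_Icc.exists_isMaxOn (Set.nonempty_Icc.2 hq.le)
      (f := fun t => f (t, u)) (fun q hq => (hD q hq u hu).continuousAt.continuousWithinAt)
  choose! qs hqs hmax using hex
  refine ⟨qs, fun u hu => ⟨hqs u hu, hmax u hu, fun t ht hm => ?_⟩, fun u hu v hv => ?_⟩
  · have h1 := hle u hu u hu t ht _ (hqs u hu) hm (hmax u hu)
    have h2 := hle u hu u hu _ (hqs u hu) t ht (hmax u hu) hm
    simp only [sub_self, norm_zero, mul_zero] at h1 h2
    linarith
  · have h1 := hle u hu v hv _ (hqs u hu) _ (hqs v hv) (hmax u hu) (hmax v hv)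
    have h2 := hle v hv u hu _ (hqs v hv) _ (hqs u hu) (hmax v hv) (hmax u hu)
    rw [norm_sub_rev] at h2
    exact abs_le.2 ⟨by linarith, by linarith⟩
end
end

section
/- Assume there exists α > 0 such that ∂²h/∂q²(q,x,a) ≤ −α for all (q,x,a) ∈ Ω, and let K₂, K₃ ∈ ℝ satisfy ‖∇²_{(x,a)}h(q,x,a)‖₂ ≤ K₂ (operator 2-norm of the Hessian in the variables (x,a)) and ‖∇_{(x,a)}(∂h/∂q)(q,x,a)‖ ≤ K₃ for all (q,x,a) ∈ Ω. For (x,a) ∈ Δ × I let q*(x,a) denote the unique maximizer of q ↦ h(q,x,a) over [q₀−ε, q₀+ε]. Then the map (x,a) ↦ ∇_{(x,a)}h(q*(x,a), x, a) is Lipschitz on Δ × I with Lipschitz constant K₃²/α + K₂. -/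
open Matrix

noncomputable section

theorem grad_sum {F : Type*} [NormedAddCommGroup F] [InnerProductSpace ℝ F] [CompleteSpace F]
    (f : Fin 4 → F → ℝ) (b : Fin 4 → ℝ) (y : F) (hf : ∀ k, DifferentiableAt ℝ (f k) y) :
    gradient (fun y => ∑ k, b k * f k y) y = ∑ k, b k • gradient (f k) y := by
  apply HasGradientAt.gradient
  rw [hasGradientAt_iff_hasFDerivAt]
  simp only [map_sum, map_smul]
  apply HasFDerivAt.fun_sum
  intro k _
  have := (hf k).hasGradientAt
  rw [hasGradientAt_iff_hasFDerivAt] at this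
  exact this.const_mul (b k)

theorem abstr {F : Type*} [NormedAddCommGroup F] [InnerProductSpace ℝ F] [CompleteSpace F]
    (c : Fin 4 → ℝ → ℝ) (f : Fin 4 → F → ℝ) (hc : ∀ k, ContDiff ℝ 2 (c k))
    (D : Set F) (hD : Convex ℝ D) (hf : ∀ k, ∀ y ∈ D, ContDiffAt ℝ 2 (f k) y)
    (l u α K₂ K₃ : ℝ) (hα : 0 < α)
    (hconc : ∀ q ∈ Set.Icc l u, ∀ y ∈ D, deriv (deriv (fun t => ∑ k, c k t * f k y)) q ≤ -α)
    (hK₂ : ∀ q ∈ Set.Icc l u, ∀ y ∈ D,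
      ‖fderiv ℝ (gradient (fun y => ∑ k, c k q * f k y)) y‖ ≤ K₂)
    (hK₃ : ∀ q ∈ Set.Icc l u, ∀ y ∈ D,
      ‖gradient (fun y => deriv (fun t => ∑ k, c k t * f k y) q) y‖ ≤ K₃)
    (q1 q2 : ℝ) (y1 y2 : F) (hq1 : q1 ∈ Set.Icc l u) (hq2 : q2 ∈ Set.Icc l u)
    (hy1 : y1 ∈ D) (hy2 : y2 ∈ D)
    (hm1 : ∀ t ∈ Set.Icc l u, ∑ k, c k t * f k y1 ≤ ∑ k, c k q1 * f k y1)
    (hm2 : ∀ t ∈ Set.Icc l u, ∑ k, c k t * f k y2 ≤ ∑ k, c k q2 * f k y2) :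
    ‖gradient (fun y => ∑ k, c k q1 * f k y) y1 - gradient (fun y => ∑ k, c k q2 * f k y) y2‖
      ≤ (K₃ ^ 2 / α + K₂) * ‖y1 - y2‖ := by
  have hcd : ∀ k t, DifferentiableAt ℝ (c k) t := fun k t =>
    (hc k).differentiable (by norm_num) t
  have hcd' : ∀ k t, DifferentiableAt ℝ (deriv (c k)) t := fun k t => by
    have : ContDiff ℝ 1 (deriv (c k)) :=
      ((contDiff_succ_iff_deriv (n := 1)).1 (by simpa [one_add_one_eq_two] using hc k)).2.2
    exact this.differentiable (by norm_num) t
  have hfd : ∀ k, ∀ y ∈ D, DifferentiableAt ℝ (f k) y := fun k y hy =>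
    (hf k y hy).differentiableAt (by norm_num)
  have hder : ∀ y t, HasDerivAt (fun t => ∑ k, c k t * f k y) (∑ k, deriv (c k) t * f k y) t := by
    intro y t
    apply HasDerivAt.fun_sum
    intro k _
    exact (hcd k t).hasDerivAt.mul_const _
  have hder' : ∀ y, deriv (fun t => ∑ k, c k t * f k y) = fun t => ∑ k, deriv (c k) t * f k y :=
    fun y => funext fun t => (hder y t).deriv
  have hdd : ∀ y t, DifferentiableAt ℝ (fun t => ∑ k, deriv (c k) t * f k y) t := by
    intro y t
    have h1 := fun k => hcd' k t
    fun_prop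
  have hgr : ∀ q, ∀ y ∈ D, gradient (fun y => ∑ k, deriv (c k) q * f k y) y
      = ∑ k, deriv (c k) q • gradient (f k) y := fun q y hy =>
    grad_sum f (fun k => deriv (c k) q) y (fun k => hfd k y hy)
  simp only [hder'] at hconc hK₃
  have hK3n : 0 ≤ K₃ := (norm_nonneg _).trans (hK₃ q1 hq1 y1 hy1)
  set φ : ℝ → F → ℝ := fun q y => ∑ k, deriv (c k) q * f k y with hφ
  -- Lipschitz of φ in y
  have hL : ∀ q ∈ Set.Icc l u, ∀ y ∈ D, ∀ z ∈ D, |φ q z - φ q y| ≤ K₃ * ‖z - y‖ := by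
    intro q hq y hy z hz
    have := hD.norm_image_sub_le_of_norm_fderiv_le (𝕜 := ℝ) (f := φ q) (C := K₃) ?_ ?_ hy hz
    · simpa using this
    · intro w hw
      have h1 := fun k => hfd k w hw
      simp only [hφ]
      fun_prop
    · intro w hw
      have := hK₃ q hq w hw
      rw [gradient, LinearIsometryEquiv.norm_map] at this
      exact this
  -- strong concavity
  have hS : ∀ y ∈ D, ∀ s ∈ Set.Icc l u, ∀ t ∈ Set.Icc l u, s ≤ t →
      φ t y - φ s y ≤ -α * (t - s) := by
    intro y hy s hs t ht hst
    refine (convex_Icc l u).image_sub_le_mul_sub_of_deriv_le (f := fun t => φ t y) (C := -α) ?_ ?_ ?_ s hs t ht hst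
    · exact fun w _ => (hdd y w).continuousAt.continuousWithinAt
    · exact fun w _ => (hdd y w).differentiableWithinAt
    · intro w hw
      exact hconc w (interior_subset hw) y hy
  -- first-order optimality
  have hO : ∀ y p, p ∈ Set.Icc l u →
      (∀ t ∈ Set.Icc l u, ∑ k, c k t * f k y ≤ ∑ k, c k p * f k y) →
      ∀ t ∈ Set.Icc l u, φ p y * (t - p) ≤ 0 := by
    intro y p hp hm t ht
    have hmax : IsLocalMaxOn (fun t => ∑ k, c k t * f k y) (Set.Icc l u) p :=
      Filter.eventually_of_mem self_mem_nhdsWithin hm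
    have := hmax.hasFDerivWithinAt_nonpos (hder y p).hasFDerivAt.hasFDerivWithinAt
      (y := t - p) (sub_mem_posTangentConeAt_of_segment_subset
        ((convex_Icc l u).segment_subset hp ht))
    have h2 : (t - p) * φ p y ≤ 0 := by simpa using this
    linarith
  have hqq : α * |q1 - q2| ≤ K₃ * ‖y1 - y2‖ := by
    have a1 := hO y1 q1 hq1 hm1 q2 hq2
    have a2 := hO y2 q2 hq2 hm2 q1 hq1
    have a3 := hL q2 hq2 y2 hy2 y1 hy1
    rw [abs_le] at a3
    rcases lt_trichotomy q1 q2 with h | h | h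
    · have b := hS y1 hy1 q1 hq1 q2 hq2 h.le
      have b1 : φ q1 y1 ≤ 0 := by nlinarith
      have b2 : 0 ≤ φ q2 y2 := by nlinarith
      rw [abs_of_neg (by linarith)]
      nlinarith
    · subst h; simp; positivity
    · have b := hS y1 hy1 q2 hq2 q1 hq1 h.le
      have b1 : 0 ≤ φ q1 y1 := by nlinarith
      have b2 : φ q2 y2 ≤ 0 := by nlinarith
      rw [abs_of_pos (by linarith)]
      nlinarith
  have hqq' : |q1 - q2| ≤ K₃ / α * ‖y1 - y2‖ := by
    rw [div_mul_eq_mul_div, le_div_iff₀ hα]; linarith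
  have hG1 : ‖gradient (fun y => ∑ k, c k q1 * f k y) y1
      - gradient (fun y => ∑ k, c k q2 * f k y) y1‖ ≤ K₃ * |q1 - q2| := by
    rw [grad_sum f (fun k => c k q1) y1 (fun k => hfd k y1 hy1),
      grad_sum f (fun k => c k q2) y1 (fun k => hfd k y1 hy1)]
    have := (convex_Icc l u).norm_image_sub_le_of_norm_hasDerivWithin_le
      (f := fun q => ∑ k, c k q • gradient (f k) y1)
      (f' := fun q => ∑ k, deriv (c k) q • gradient (f k) y1) (C := K₃) ?_ ?_ hq2 hq1
    · simpa using this
    · intro t _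
      apply HasDerivAt.hasDerivWithinAt
      apply HasDerivAt.fun_sum
      intro k _
      exact (hcd k t).hasDerivAt.smul_const _
    · intro t ht
      rw [← hgr t y1 hy1]
      exact hK₃ t ht y1 hy1
  have hG2 : ‖gradient (fun y => ∑ k, c k q2 * f k y) y1
      - gradient (fun y => ∑ k, c k q2 * f k y) y2‖ ≤ K₂ * ‖y1 - y2‖ := by
    refine hD.norm_image_sub_le_of_norm_fderiv_le (𝕜 := ℝ) ?_ (fun w hw => hK₂ q2 hq2 w hw) hy2 hy1
    intro w hw
    have h1 := fun k => hf k w hw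
    have h2 : ContDiffAt ℝ 2 (fun y => ∑ k, c k q2 * f k y) w := by fun_prop
    have h3 : DifferentiableAt ℝ (fderiv ℝ (fun y => ∑ k, c k q2 * f k y)) w :=
      (h2.fderiv_right (m := 1) (by norm_num)).differentiableAt (by norm_num)
    exact ((InnerProductSpace.toDual ℝ F).symm.toContinuousLinearEquiv.differentiableAt).comp w h3
  calc _ ≤ K₃ * |q1 - q2| + K₂ * ‖y1 - y2‖ := by
        refine (norm_sub_le_norm_sub_add_norm_sub _
          (gradient (fun y => ∑ k, c k q2 * f k y) y1) _).trans (add_le_add hG1 hG2)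
    _ ≤ K₃ * (K₃ / α * ‖y1 - y2‖) + K₂ * ‖y1 - y2‖ := by gcongr
    _ = _ := by ring

theorem quad_pos (d : ℕ) (M : Matrix (Fin d) (Fin d) ℝ) (h : M.PosDef) (x : E d) (hx : x ≠ 0) :
    0 < x ⬝ᵥ M.mulVec x := by
  have h0 : (x : Fin d → ℝ) ≠ 0 := by
    intro h0; apply hx; ext i; exact congrFun h0 i
  have := h.dotProduct_mulVec_pos h0
  simpa using this

theorem simplex_ne {d : ℕ} {x : E d} (hx : x ∈ simplexSet d) : x ≠ 0 := by
  rintro rfl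
  have := hx.2
  simp at this

theorem snd_smooth (d : ℕ) (y : Pair d) :
    ContDiffAt ℝ 2 (fun y : Pair d => y.snd) y := by
  exact ((ContinuousLinearMap.snd ℝ (E d) ℝ).comp
    (WithLp.prodContinuousLinearEquiv 2 ℝ (E d) ℝ : Pair d →L[ℝ] E d × ℝ)).contDiff.contDiffAt

theorem fst_smooth (d : ℕ) (y : Pair d) :
    ContDiffAt ℝ 2 (fun y : Pair d => y.fst) y := by
  exact ((ContinuousLinearMap.fst ℝ (E d) ℝ).comp
    (WithLp.prodContinuousLinearEquiv 2 ℝ (E d) ℝ : Pair d →L[ℝ] E d × ℝ)).contDiff.contDiffAt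

theorem quad_smooth (d : ℕ) (M : Matrix (Fin d) (Fin d) ℝ) (y : Pair d) :
    ContDiffAt ℝ 2 (fun y : Pair d => y.fst ⬝ᵥ M.mulVec y.fst) y := by
  simp only [dotProduct, Matrix.mulVec]
  have h := fst_smooth d y
  fun_prop

theorem lin_smooth (d : ℕ) (m : E d) (y : Pair d) :
    ContDiffAt ℝ 2 (fun y : Pair d => y.fst ⬝ᵥ m) y := by
  simp only [dotProduct]
  have h := fst_smooth d y
  fun_prop

theorem S_smooth (d : ℕ) (SigS : Matrix (Fin d) (Fin d) ℝ) (h : SigS.PosDef) (μS : E d) (γ : ℝ)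
    (y : Pair d) (hy : y.fst ≠ 0) :
    ContDiffAt ℝ 2 (fun y : Pair d => Sfn d SigS μS γ y.fst y.snd) y := by
  unfold Sfn
  have h1 := quad_smooth d SigS y
  have h2 := lin_smooth d μS y
  have h3 := snd_smooth d y
  refine ContDiffAt.sqrt (by fun_prop) ?_
  have := quad_pos d SigS h _ hy
  positivity

/-- if `∂²h/∂q² ≤ −α` on `Ω`, the operator 2-norm of the Hessian of `h` in
`(x,a)` is at most `K₂` on `Ω`, and `‖∇_{(x,a)}(∂h/∂q)‖ ≤ K₃` on `Ω`, then
`(x,a) ↦ ∇_{(x,a)}h(q*(x,a),x,a)` is `(K₃²/α + K₂)`-Lipschitz on `Δ × I`, where `q*(x,a)`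
is the (unique) maximizer of `q ↦ h(q,x,a)` over `[q₀−ε, q₀+ε]`. -/
theorem stmt8 (d : ℕ) (hd : 1 ≤ d)
    (γ : ℝ) (hγ : 0 < γ) (μN μS : E d) (SigN SigS : Matrix (Fin d) (Fin d) ℝ)
    (hSymN : SigN.IsSymm) (hPDN : SigN.PosDef) (hSymS : SigS.IsSymm) (hPDS : SigS.PosDef)
    (r : ℝ → ℝ) (hr : ContDiff ℝ 2 r) (hrpos : ∀ q, 0 ≤ r q)
    (q₀ ε : ℝ) (hε : 0 ≤ ε) (hq1 : 0 < q₀ - ε) (hq2 : q₀ + ε < 1)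
    (lo hi : ℝ) (hIo : lo ≤ hi)
    (α : ℝ) (hα : 0 < α)
    (hconc : ∀ q ∈ Set.Icc (q₀ - ε) (q₀ + ε), ∀ x ∈ simplexSet d, ∀ a ∈ Set.Icc lo hi,
      deriv (deriv (fun t => hfn d SigN SigS μN μS γ r t x a)) q ≤ -α)
    (K₂ K₃ : ℝ)
    (hK₂ : ∀ q ∈ Set.Icc (q₀ - ε) (q₀ + ε), ∀ x ∈ simplexSet d, ∀ a ∈ Set.Icc lo hi,
      ‖fderiv ℝ (gradh d SigN SigS μN μS γ r q) (mkPair d x a)‖ ≤ K₂)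
    (hK₃ : ∀ q ∈ Set.Icc (q₀ - ε) (q₀ + ε), ∀ x ∈ simplexSet d, ∀ a ∈ Set.Icc lo hi,
      ‖gradient (fun y : Pair d =>
          deriv (fun t => hfn d SigN SigS μN μS γ r t (WithLp.equiv 2 (E d × ℝ) y).1
            (WithLp.equiv 2 (E d × ℝ) y).2) q) (mkPair d x a)‖ ≤ K₃)
    (qs : E d → ℝ → ℝ)
    (hqs : ∀ x ∈ simplexSet d, ∀ a ∈ Set.Icc lo hi,
      qs x a ∈ Set.Icc (q₀ - ε) (q₀ + ε)
        ∧ ∀ t ∈ Set.Icc (q₀ - ε) (q₀ + ε),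
            hfn d SigN SigS μN μS γ r t x a ≤ hfn d SigN SigS μN μS γ r (qs x a) x a) :
    ∀ x ∈ simplexSet d, ∀ a ∈ Set.Icc lo hi, ∀ x' ∈ simplexSet d, ∀ a' ∈ Set.Icc lo hi,
      ‖gradh d SigN SigS μN μS γ r (qs x a) (mkPair d x a)
          - gradh d SigN SigS μN μS γ r (qs x' a') (mkPair d x' a')‖
        ≤ (K₃ ^ 2 / α + K₂) * ‖mkPair d x a - mkPair d x' a'‖ := by
  intro x hx a ha x' hx' a' ha'
  let c : Fin 4 → ℝ → ℝ := ![fun q => 1 - q, fun q => q, fun q => q * r q ^ 2,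
    fun q => 2 * (q * r q)]
  let f : Fin 4 → Pair d → ℝ := ![fun y => eNfn d SigN μN γ y.fst y.snd,
    fun y => Sfn d SigS μS γ y.fst y.snd ^ 2 - y.snd * γ - γ ^ 2 / 4,
    fun y => ‖y.fst‖ ^ 2, fun y => ‖y.fst‖ * Sfn d SigS μS γ y.fst y.snd]
  have key : ∀ q (y : Pair d), hfn d SigN SigS μN μS γ r q y.fst y.snd = ∑ k, c k q * f k y := by
    intro q y
    simp only [Fin.sum_univ_four, hfn, Vfn, c, f, Matrix.cons_val]
    ring
  let D : Set (Pair d) := {y | y.fst ∈ simplexSet d ∧ y.snd ∈ Set.Icc lo hi}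
  have hDm : ∀ x ∈ simplexSet d, ∀ a ∈ Set.Icc lo hi, mkPair d x a ∈ D :=
    fun x hx a ha => ⟨hx, ha⟩
  have hD : Convex ℝ D := by
    intro y hy z hz s t hs ht hst
    refine ⟨⟨fun i => ?_, ?_⟩, ?_⟩
    · have h1 := hy.1.1 i
      have h2 := hz.1.1 i
      simp
      positivity
    · have h1 := hy.1.2
      have h2 := hz.1.2
      simp [Finset.sum_add_distrib, ← Finset.mul_sum, h1, h2, hst]
    · exact (convex_Icc lo hi) hy.2 hz.2 hs ht hst
  have hc : ∀ k, ContDiff ℝ 2 (c k) := by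
    intro k
    fin_cases k <;> simp [c] <;> fun_prop
  have hf : ∀ k, ∀ y ∈ D, ContDiffAt ℝ 2 (f k) y := by
    intro k y hy
    have hne := simplex_ne hy.1
    have h0 := quad_smooth d SigN y
    have h2 := lin_smooth d μN y
    have h3 := snd_smooth d y
    have h4 := S_smooth d SigS hPDS μS γ y hne
    have h5 : ContDiffAt ℝ 2 (fun y : Pair d => ‖y.fst‖) y := (fst_smooth d y).norm ℝ hne
    fin_cases k <;> simp [f, eNfn] <;> fun_prop
  have hg : ∀ q, gradh d SigN SigS μN μS γ r q = gradient (fun y => ∑ k, c k q * f k y) := by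
    intro q
    funext y
    unfold gradh
    congr 1
    funext z
    exact key q z
  simp only [hg] at hK₂ ⊢
  refine abstr c f hc D hD hf (q₀ - ε) (q₀ + ε) α K₂ K₃ hα ?_ ?_ ?_ _ _ _ _
    (hqs x hx a ha).1 (hqs x' hx' a' ha').1 (hDm x hx a ha) (hDm x' hx' a' ha') ?_ ?_
  · intro q hq y hy
    simp only [← key]
    exact hconc q hq _ hy.1 _ hy.2
  · intro q hq y hy
    exact hK₂ q hq _ hy.1 _ hy.2
  · intro q hq y hy
    simp only [← key]
    exact hK₃ q hq _ hy.1 _ hy.2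
  · intro t ht
    rw [← key, ← key]
    exact (hqs x hx a ha).2 t ht
  · intro t ht
    rw [← key, ← key]
    exact (hqs x' hx' a' ha').2 t ht
end
end

section
/- Let (x̂,â) ∈ Δ × I and let q* ∈ [q₀−ε, q₀+ε] satisfy h(q*, x̂, â) = J(x̂, â). Define g_x = (1−q*)·(2(Σ_N + μ_N μ_Nᵀ)x̂ − (2â+γ)·μ_N) + q*·2·(r(q*)‖x̂‖ + S(x̂,â))·( r(q*)·x̂/‖x̂‖ + (Σ_S x̂ + (x̂ᵀμ_S − (2â+γ)/2)·μ_S)/S(x̂,â) ) ∈ ℝ^d and g_a = −2(1−q*)·(x̂ᵀμ_N − â) + q*·( −2·((r(q*)‖x̂‖ + S(x̂,â))/S(x̂,â))·(x̂ᵀμ_S − (2â+γ)/2) − γ ) ∈ ℝ. Then (g_x, g_a) is a subgradient of J at (x̂,â) on Δ × I: for every (y,b) ∈ Δ × I, J(y,b) ≥ J(x̂,â) + ⟨g_x, y − x̂⟩ + g_a·(b − â). -/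
open Matrix

noncomputable section

theorem aux_quad_s9 {d : ℕ} (M : Matrix (Fin d) (Fin d) ℝ) (hs : M.IsSymm) (hp : M.PosDef)
    (x y : Fin d → ℝ) (s t : ℝ) :
    0 ≤ s ^ 2 * (x ⬝ᵥ M.mulVec x) - 2 * s * t * (y ⬝ᵥ M.mulVec x)
      + t ^ 2 * (y ⬝ᵥ M.mulVec y) := by
  have h := hp.posSemidef.dotProduct_mulVec_nonneg (s • x - t • y)
  have e : x ⬝ᵥ M.mulVec y = y ⬝ᵥ M.mulVec x := by
    rw [dotProduct_mulVec, ← mulVec_transpose, hs.eq, dotProduct_comm]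
  simp only [star_trivial, mulVec_sub, mulVec_smul, dotProduct_sub, sub_dotProduct,
    smul_dotProduct, dotProduct_smul, smul_eq_mul, e] at h
  linarith

theorem aux_V (R n m P S T A B C u v : ℝ) (hR : 0 ≤ R) (hn : 0 < n) (hS : 0 < S)
    (hP : P ≤ n * m) (hT : 0 < T) (hS2 : S ^ 2 = A + u ^ 2) (hT2 : T ^ 2 = C + v ^ 2)
    (hq : 0 ≤ T ^ 2 * A - 2 * T * S * B + S ^ 2 * C) :
    (R * n + S) ^ 2 + 2 * (R * n + S) * (R * ((P - n ^ 2) / n)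
      + (B - A + u * (v - u)) / S) ≤ (R * m + T) ^ 2 := by
  have h1 : (P - n ^ 2) / n ≤ m - n := by
    rw [div_le_iff₀ hn]; nlinarith
  have h2 : B + u * v ≤ S * T := by
    have : 0 ≤ (T * S) * (S * T - (B + u * v)) := by
      nlinarith [sq_nonneg (T * u - S * v)]
    have := nonneg_of_mul_nonneg_right this (mul_pos hT hS)
    linarith
  have h3 : (B - A + u * (v - u)) / S ≤ T - S := by
    rw [div_le_iff₀ hS]; nlinarith
  have h4 := mul_le_mul_of_nonneg_left h1 hR
  have h5 : 0 ≤ R * n + S := by positivity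
  have h6 := mul_le_mul_of_nonneg_left (add_le_add h4 h3) (mul_nonneg zero_le_two h5)
  nlinarith [sq_nonneg (R * m + T - (R * n + S))]

theorem aux_pos {d : ℕ} (M : Matrix (Fin d) (Fin d) ℝ) (hp : M.PosDef)
    (x : E d) (hx : x ∈ simplexSet d) : 0 < ‖x‖ ∧ 0 < x ⬝ᵥ M.mulVec x := by
  have h0 : x ≠ 0 := by
    rintro rfl
    have := hx.2
    simp at this
  refine ⟨norm_pos_iff.2 h0, ?_⟩
  have h1 : (x : Fin d → ℝ) ≠ 0 := by
    intro h
    apply h0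
    ext i
    exact congrFun h i
  simpa using hp.dotProduct_mulVec_pos h1

/-- the explicit vector `(g_x, g_a)` built from a maximizer `q*` of
`q ↦ h(q,x̂,â)` is a subgradient of `J` at `(x̂,â)` on `Δ × I`. -/
theorem stmt9 (d : ℕ) (hd : 1 ≤ d)
    (γ : ℝ) (hγ : 0 < γ) (μN μS : E d) (SigN SigS : Matrix (Fin d) (Fin d) ℝ)
    (hSymN : SigN.IsSymm) (hPDN : SigN.PosDef) (hSymS : SigS.IsSymm) (hPDS : SigS.PosDef)
    (r : ℝ → ℝ) (hr : ContDiff ℝ 2 r) (hrpos : ∀ q, 0 ≤ r q)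
    (q₀ ε : ℝ) (hε : 0 ≤ ε) (hq1 : 0 < q₀ - ε) (hq2 : q₀ + ε < 1)
    (lo hi : ℝ) (hIo : lo ≤ hi)
    (xh : E d) (ah : ℝ) (hxh : xh ∈ simplexSet d) (hah : ah ∈ Set.Icc lo hi)
    (qs : ℝ) (hqsmem : qs ∈ Set.Icc (q₀ - ε) (q₀ + ε))
    (hqsmax : hfn d SigN SigS μN μS γ r qs xh ah = Jfn d SigN SigS μN μS γ r q₀ ε xh ah) :
    ∀ y ∈ simplexSet d, ∀ b ∈ Set.Icc lo hi,
      Jfn d SigN SigS μN μS γ r q₀ ε y b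
        ≥ Jfn d SigN SigS μN μS γ r q₀ ε xh ah
          + (fun i =>
              (1 - qs) * (2 * ((SigN + vecMulVec μN μN).mulVec xh i) - (2 * ah + γ) * μN i)
                + qs * (2 * (r qs * ‖xh‖ + Sfn d SigS μS γ xh ah)
                    * (r qs * (xh i / ‖xh‖)
                      + (SigS.mulVec xh i + (xh ⬝ᵥ μS - (2 * ah + γ) / 2) * μS i)
                          / Sfn d SigS μS γ xh ah)))
              ⬝ᵥ (fun i => y i - xh i)
          + ((1 - qs) * (-2 * (xh ⬝ᵥ μN - ah))
              + qs * (-2 * ((r qs * ‖xh‖ + Sfn d SigS μS γ xh ah) / Sfn d SigS μS γ xh ah)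
                  * (xh ⬝ᵥ μS - (2 * ah + γ) / 2) - γ))
            * (b - ah) := by
  intro y hy b hb
  obtain ⟨hn, hA⟩ := aux_pos SigS hPDS xh hxh
  obtain ⟨hm, hC⟩ := aux_pos SigS hPDS y hy
  have hJ : hfn d SigN SigS μN μS γ r qs y b ≤ Jfn d SigN SigS μN μS γ r q₀ ε y b := by
    apply le_csSup
    · apply (isCompact_Icc.image _).bddAbove
      have := hr.continuous
      unfold hfn Vfn
      fun_prop
    · exact ⟨qs, hqsmem, rfl⟩
  rw [← hqsmax]
  refine le_trans ?_ hJ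
  have hS2 : Sfn d SigS μS γ xh ah ^ 2 = xh ⬝ᵥ SigS.mulVec xh + (xh ⬝ᵥ μS - (2 * ah + γ) / 2) ^ 2 :=
    Real.sq_sqrt (by positivity)
  have hT2 : Sfn d SigS μS γ y b ^ 2 = y ⬝ᵥ SigS.mulVec y + (y ⬝ᵥ μS - (2 * b + γ) / 2) ^ 2 :=
    Real.sq_sqrt (by positivity)
  have hS : 0 < Sfn d SigS μS γ xh ah := Real.sqrt_pos.2 (by positivity)
  have hT : 0 < Sfn d SigS μS γ y b := Real.sqrt_pos.2 (by positivity)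
  have hP : xh ⬝ᵥ y ≤ ‖xh‖ * ‖y‖ := by
    have := real_inner_le_norm xh y
    rwa [EuclideanSpace.inner_eq_star_dotProduct, star_trivial, dotProduct_comm] at this
  have hnn : xh ⬝ᵥ xh = ‖xh‖ ^ 2 := by
    rw [← real_inner_self_eq_norm_sq, EuclideanSpace.inner_eq_star_dotProduct, star_trivial]
  have hV := aux_V (r qs) ‖xh‖ ‖y‖ (xh ⬝ᵥ y) _ _ _ _ _ _ _ (hrpos qs) hn hS hP hT hS2 hT2
    (aux_quad_s9 SigS hSymS hPDS xh y _ _)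
  have hN := aux_quad_s9 SigN hSymN hPDN xh y 1 1
  unfold hfn Vfn eNfn
  generalize Sfn d SigS μS γ xh ah = S at *
  generalize Sfn d SigS μS γ y b = T at *
  have hlin : (fun i =>
              (1 - qs) * (2 * ((SigN + vecMulVec μN μN).mulVec xh i) - (2 * ah + γ) * μN i)
                + qs * (2 * (r qs * ‖xh‖ + S)
                    * (r qs * (xh i / ‖xh‖)
                      + (SigS.mulVec xh i + (xh ⬝ᵥ μS - (2 * ah + γ) / 2) * μS i)
                          / S)))
              ⬝ᵥ (fun i => y i - xh i)
      = (1 - qs) * (2 * (y ⬝ᵥ SigN.mulVec xh - xh ⬝ᵥ SigN.mulVec xh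
          + (xh ⬝ᵥ μN) * (y ⬝ᵥ μN - xh ⬝ᵥ μN)) - (2 * ah + γ) * (y ⬝ᵥ μN - xh ⬝ᵥ μN))
        + qs * (2 * (r qs * ‖xh‖ + S) * (r qs * ((xh ⬝ᵥ y - ‖xh‖ ^ 2) / ‖xh‖)
          + (y ⬝ᵥ SigS.mulVec xh - xh ⬝ᵥ SigS.mulVec xh
            + (xh ⬝ᵥ μS - (2 * ah + γ) / 2) * (y ⬝ᵥ μS - xh ⬝ᵥ μS)) / S)) := by
    have e : (fun i =>
              (1 - qs) * (2 * ((SigN + vecMulVec μN μN).mulVec xh i) - (2 * ah + γ) * μN i)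
                + qs * (2 * (r qs * ‖xh‖ + S)
                    * (r qs * (xh i / ‖xh‖)
                      + (SigS.mulVec xh i + (xh ⬝ᵥ μS - (2 * ah + γ) / 2) * μS i)
                          / S)))
        = ((1 - qs) * 2) • (SigN.mulVec xh)
          + ((1 - qs) * (2 * (xh ⬝ᵥ μN) - (2 * ah + γ))) • (μN : Fin d → ℝ)
          + (qs * (2 * (r qs * ‖xh‖ + S)) * r qs / ‖xh‖) • (xh : Fin d → ℝ)
          + (qs * (2 * (r qs * ‖xh‖ + S)) / S) • (SigS.mulVec xh)
          + (qs * (2 * (r qs * ‖xh‖ + S)) / S * (xh ⬝ᵥ μS - (2 * ah + γ) / 2))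
            • (μS : Fin d → ℝ) := by
      ext i
      simp only [add_mulVec, vecMulVec_mulVec, Pi.add_apply, Pi.smul_apply, smul_eq_mul,
        MulOpposite.smul_eq_mul_unop, MulOpposite.unop_op, dotProduct_comm μN.ofLp xh.ofLp]
      ring
    have e2 : (fun i => y i - xh i) = (y : Fin d → ℝ) - (xh : Fin d → ℝ) := rfl
    rw [e, e2, ← hnn]
    simp only [add_dotProduct, smul_dotProduct, dotProduct_sub, smul_eq_mul]
    rw [dotProduct_comm (SigN.mulVec _) y.ofLp, dotProduct_comm (SigN.mulVec _) xh.ofLp,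
      dotProduct_comm (SigS.mulVec _) y.ofLp, dotProduct_comm (SigS.mulVec _) xh.ofLp,
      dotProduct_comm μN.ofLp y.ofLp, dotProduct_comm μN.ofLp xh.ofLp,
      dotProduct_comm μS.ofLp y.ofLp, dotProduct_comm μS.ofLp xh.ofLp]
    ring
  rw [hlin]
  have hq0 : 0 ≤ qs := by linarith [hqsmem.1]
  have hq1' : 0 ≤ 1 - qs := by linarith [hqsmem.2]
  have k1 := mul_le_mul_of_nonneg_left hV hq0
  have k2 := mul_nonneg hq1' (add_nonneg hN (sq_nonneg (y ⬝ᵥ μN - b - (xh ⬝ᵥ μN - ah))))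
  rw [← sub_nonneg] at k1 ⊢
  refine le_of_le_of_eq (add_nonneg k1 k2) ?_
  ring
end
end

section
/- Assume r'(q₀) = 0, r''(q₀) < 0 and r(q₀) > 0, and set K₄ = −q₀·r(q₀)·r''(q₀)/d, so K₄ > 0. Then there exists ε₀ with 0 < ε₀ ≤ ε such that for all q ∈ [q₀−ε₀, q₀+ε₀] and all (x,a) ∈ Δ × I, ∂²h/∂q²(q,x,a) ≤ −K₄. -/
open Matrix

noncomputable section

theorem aux_deriv2 (r : ℝ → ℝ) (hr : ContDiff ℝ 2 r) (e n S c₁ c₂ q : ℝ) :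
    deriv (deriv (fun t => (1 - t) * e + t * ((r t * n + S) ^ 2 - c₁ - c₂))) q
      = n * (2 * (r q * n + S) * (2 * deriv r q + q * deriv (deriv r) q)
          + 2 * q * deriv r q ^ 2 * n) := by
  have h1 : ∀ t, HasDerivAt r (deriv r t) t := fun t =>
    ((hr.differentiable (by norm_num)) t).hasDerivAt
  have hr2 : ContDiff ℝ 1 (deriv r) := by
    have : ContDiff ℝ (1 + 1) r := by simpa [one_add_one_eq_two] using hr
    exact (contDiff_succ_iff_deriv.1 this).2.2
  have h2 : ∀ t, HasDerivAt (deriv r) (deriv (deriv r) t) t := fun t =>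
    ((hr2.differentiable (by norm_num)) t).hasDerivAt
  have e1 : deriv (fun t => (1 - t) * e + t * ((r t * n + S) ^ 2 - c₁ - c₂))
      = fun t => -e + ((r t * n + S) ^ 2 - c₁ - c₂)
          + t * (2 * (r t * n + S) * (deriv r t * n)) := by
    funext t
    have hid := hasDerivAt_id' t
    have := ((hid.const_sub 1).mul_const e).add
      (hid.mul ((((((h1 t).mul_const n).add_const S).pow 2).sub_const c₁).sub_const c₂))
    refine HasDerivAt.deriv (this.congr_deriv ?_)
    norm_num
    ring
  rw [e1]
  have hid := hasDerivAt_id' q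
  have hg := ((h1 q).mul_const n).add_const S
  have := ((((hg.pow 2).sub_const c₁).sub_const c₂).const_add (-e)).add
    (hid.mul ((hg.const_mul 2).mul ((h2 q).mul_const n)))
  refine HasDerivAt.deriv (this.congr_deriv ?_)
  norm_num
  ring

theorem aux_norm_s11 (d : ℕ) (x : E d) (hx : x ∈ simplexSet d) : 1 ≤ (d : ℝ) * ‖x‖ ^ 2 := by
  have h := sq_sum_le_card_mul_sum_sq (s := Finset.univ) (f := fun i => x i)
  rw [hx.2] at h
  rw [EuclideanSpace.norm_sq_eq]
  simpa using h

/-- if `r'(q₀) = 0`, `r''(q₀) < 0` and `r(q₀) > 0`, then with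
`K₄ = −q₀·r(q₀)·r''(q₀)/d > 0` there is `0 < ε₀ ≤ ε` such that
`∂²h/∂q²(q,x,a) ≤ −K₄` for all `q ∈ [q₀−ε₀, q₀+ε₀]` and `(x,a) ∈ Δ × I`. -/
theorem stmt11 (d : ℕ) (hd : 1 ≤ d)
    (γ : ℝ) (hγ : 0 < γ) (μN μS : E d) (SigN SigS : Matrix (Fin d) (Fin d) ℝ)
    (hSymN : SigN.IsSymm) (hPDN : SigN.PosDef) (hSymS : SigS.IsSymm) (hPDS : SigS.PosDef)
    (r : ℝ → ℝ) (hr : ContDiff ℝ 2 r) (hrpos : ∀ q, 0 ≤ r q)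
    (q₀ ε : ℝ) (hε : 0 < ε) (hq1 : 0 < q₀ - ε) (hq2 : q₀ + ε < 1)
    (lo hi : ℝ) (hIo : lo ≤ hi)
    (hr' : deriv r q₀ = 0) (hr'' : deriv (deriv r) q₀ < 0) (hrq₀ : 0 < r q₀) :
    0 < -q₀ * r q₀ * deriv (deriv r) q₀ / d
      ∧ ∃ ε₀ : ℝ, 0 < ε₀ ∧ ε₀ ≤ ε ∧
          ∀ q ∈ Set.Icc (q₀ - ε₀) (q₀ + ε₀), ∀ x ∈ simplexSet d, ∀ a ∈ Set.Icc lo hi,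
            deriv (deriv (fun t => hfn d SigN SigS μN μS γ r t x a)) q
              ≤ -(-q₀ * r q₀ * deriv (deriv r) q₀ / d) := by
  have hq0 : 0 < q₀ := by linarith
  have hd0 : (0 : ℝ) < d := by exact_mod_cast hd
  have hB : q₀ * r q₀ * deriv (deriv r) q₀ < 0 :=
    mul_neg_of_pos_of_neg (mul_pos hq0 hrq₀) hr''
  refine ⟨div_pos (by linarith) hd0, ?_⟩
  have hc0 : Continuous r := hr.continuous
  have hr2 : ContDiff ℝ 1 (deriv r) := by
    have : ContDiff ℝ (1 + 1) r := by simpa [one_add_one_eq_two] using hr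
    exact (contDiff_succ_iff_deriv.1 this).2.2
  have hc1 : Continuous (deriv r) := hr2.continuous
  have hc2 : Continuous (deriv (deriv r)) := hr2.continuous_deriv (by norm_num)
  have hG : Continuous fun q => 2 * deriv r q + q * deriv (deriv r) q := by fun_prop
  have hF : Continuous fun q => 2 * r q * (2 * deriv r q + q * deriv (deriv r) q)
      + 2 * q * deriv r q ^ 2 := by fun_prop
  have ev1 := hG.continuousAt.eventually_lt (x₀ := q₀) continuousAt_const
    (show _ < (0 : ℝ) by simp only [hr']; nlinarith)
  have ev2 := hF.continuousAt.eventually_lt (x₀ := q₀) continuousAt_const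
    (show _ < q₀ * r q₀ * deriv (deriv r) q₀ by simp only [hr']; nlinarith)
  obtain ⟨δ, hδ, hball⟩ := Metric.eventually_nhds_iff.1 (ev1.and ev2)
  refine ⟨min ε (δ / 2), lt_min hε (by linarith), min_le_left _ _, ?_⟩
  intro q hq x hx a _
  have hm := min_le_right ε (δ / 2)
  obtain ⟨hlt1, hlt2⟩ := hball (y := q) (by
    rw [Real.dist_eq, abs_lt]; constructor <;> linarith [hq.1, hq.2])
  have hn := aux_norm_s11 d x hx
  have hS : 0 ≤ Sfn d SigS μS γ x a := Real.sqrt_nonneg _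
  have hn0 := norm_nonneg x
  have key := aux_deriv2 r hr (eNfn d SigN μN γ x a) ‖x‖ (Sfn d SigS μS γ x a)
    (a * γ) (γ ^ 2 / 4) q
  have hfun : (fun t => hfn d SigN SigS μN μS γ r t x a)
      = fun t => (1 - t) * eNfn d SigN μN γ x a
        + t * ((r t * ‖x‖ + Sfn d SigS μS γ x a) ^ 2 - a * γ - γ ^ 2 / 4) := rfl
  rw [hfun, key]
  generalize Sfn d SigS μS γ x a = S at *
  generalize ‖x‖ = n at *
  set G := 2 * deriv r q + q * deriv (deriv r) q
  set B := q₀ * r q₀ * deriv (deriv r) q₀ with hBdef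
  have hrhs : -(-q₀ * r q₀ * deriv (deriv r) q₀ / d) = B / d := by rw [hBdef]; ring
  rw [hrhs, le_div_iff₀ hd0]
  have hnS : n * S * G ≤ 0 :=
    mul_nonpos_of_nonneg_of_nonpos (mul_nonneg hn0 hS) hlt1.le
  have h1 : n * (2 * (r q * n + S) * G + 2 * q * deriv r q ^ 2 * n) ≤ n ^ 2 * B := by
    have := mul_le_mul_of_nonneg_left hlt2.le (sq_nonneg n)
    nlinarith
  have h2 := mul_le_mul_of_nonneg_right h1 hd0.le
  nlinarith
end
end

section
/- Let r_base : ℝ → ℝ be continuous and nonnegative on [0,1], and suppose there exists q̄ ∈ [q₀−ε, q₀+ε] with r_base(q̄) > 0. For each C > 0, let J_C(x,a) = max_{q ∈ [q₀−ε, q₀+ε]} [ (1−q)·e_N(x,a) + q·( (C·r_base(q)·‖x‖ + S(x,a))² − aγ − γ²/4 ) ], and let (x_C, a_C) ∈ Δ × I be a minimizer of J_C over Δ × I. Then x_C converges to the equal-weighted vector (1/d, …, 1/d) as C → ∞. -/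
open Matrix

noncomputable section

theorem aux_eN (d : ℕ) (γ : ℝ) (hγ : 0 < γ) (μN : E d) (SigN : Matrix (Fin d) (Fin d) ℝ)
    (hPDN : SigN.PosDef) (x : E d) (hx : x ∈ simplexSet d) (a : ℝ) :
    -(γ * ∑ i, |μN i|) ≤ eNfn d SigN μN γ x a := by
  have h1 : 0 ≤ x ⬝ᵥ SigN.mulVec x := by
    have := hPDN.posSemidef.dotProduct_mulVec_nonneg x
    simpa using this
  have h2 : x ⬝ᵥ μN ≤ ∑ i, |μN i| := by
    unfold dotProduct
    apply Finset.sum_le_sum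
    intro i _
    have hi0 := hx.1 i
    have hi1 : x i ≤ 1 := by
      rw [← hx.2]
      exact Finset.single_le_sum (f := fun i => x i) (fun j _ => hx.1 j) (Finset.mem_univ i)
    have := abs_nonneg (μN i)
    calc x i * μN i ≤ x i * |μN i| := mul_le_mul_of_nonneg_left (le_abs_self _) hi0
      _ ≤ |μN i| := by nlinarith
  unfold eNfn
  have := mul_le_mul_of_nonneg_left h2 hγ.le
  nlinarith [sq_nonneg (x ⬝ᵥ μN - a)]

theorem aux_upper (d : ℕ) (γ : ℝ) (hγ : 0 < γ) (μN μS : E d) (SigN SigS : Matrix (Fin d) (Fin d) ℝ)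
    (r : ℝ → ℝ) (A R C q : ℝ) (hC : 0 < C) (hq0 : 0 ≤ q) (hq1 : q ≤ 1) (hr0 : 0 ≤ r q)
    (hR : r q ≤ R) (hA : q * r q ^ 2 ≤ A) (x : E d) (a : ℝ) :
    hfn d SigN SigS μN μS γ (fun q => C * r q) q x a ≤
      A * C ^ 2 * ‖x‖ ^ 2 + C * (2 * R * ‖x‖ * Sfn d SigS μS γ x a)
        + (|eNfn d SigN μN γ x a| + Sfn d SigS μS γ x a ^ 2 + |a| * γ) := by
  unfold hfn Vfn
  have hS : 0 ≤ Sfn d SigS μS γ x a := Real.sqrt_nonneg _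
  generalize Sfn d SigS μS γ x a = S at *
  generalize eNfn d SigN μN γ x a = e at *
  have hn := norm_nonneg x
  generalize ‖x‖ = n at *
  have e1 : (1 - q) * e ≤ |e| := by
    have := le_abs_self e
    have := abs_nonneg e
    nlinarith
  have e2 : q * r q ^ 2 * (C ^ 2 * n ^ 2) ≤ A * (C ^ 2 * n ^ 2) :=
    mul_le_mul_of_nonneg_right hA (by positivity)
  have e3 : q * r q ≤ R := by nlinarith
  have e4 : q * r q * (2 * C * n * S) ≤ R * (2 * C * n * S) :=
    mul_le_mul_of_nonneg_right e3 (by positivity)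
  have e5 : q * S ^ 2 ≤ S ^ 2 := by nlinarith [sq_nonneg S]
  have e6 : q * (-a * γ) ≤ |a| * γ := by
    have h1 := neg_abs_le a
    have h2 := abs_nonneg a
    have : q * (-a) ≤ |a| := by nlinarith
    nlinarith
  have e7 : 0 ≤ q * (γ ^ 2 / 4) := by positivity
  nlinarith

theorem aux_lower (d : ℕ) (γ : ℝ) (hγ : 0 < γ) (μN μS : E d) (SigN SigS : Matrix (Fin d) (Fin d) ℝ)
    (hPDN : SigN.PosDef)
    (r : ℝ → ℝ) (C q hi : ℝ) (hC : 0 < C) (hq0 : 0 ≤ q) (hq1 : q ≤ 1) (hr0 : 0 ≤ r q)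
    (x : E d) (hx : x ∈ simplexSet d) (a : ℝ) (ha : a ≤ hi) :
    q * r q ^ 2 * C ^ 2 * ‖x‖ ^ 2 - (γ * ∑ i, |μN i| + |hi| * γ + γ ^ 2 / 4) ≤
    hfn d SigN SigS μN μS γ (fun q => C * r q) q x a := by
  have h0 := aux_eN d γ hγ μN SigN hPDN x hx a
  have hm : 0 ≤ γ * ∑ i, |μN i| := by positivity
  unfold hfn Vfn
  have hS : 0 ≤ Sfn d SigS μS γ x a := Real.sqrt_nonneg _
  generalize Sfn d SigS μS γ x a = S at *
  generalize eNfn d SigN μN γ x a = e at *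
  have hn := norm_nonneg x
  generalize ‖x‖ = n at *
  generalize γ * ∑ i, |μN i| = m at *
  have e1 : -m ≤ (1 - q) * e := by nlinarith
  have e4 : 0 ≤ q * r q * (2 * C * n * S) := by positivity
  have e5 : 0 ≤ q * S ^ 2 := by positivity
  have e6 : -(|hi| * γ) ≤ q * (-a * γ) := by
    have h1 := le_abs_self hi
    have h2 := abs_nonneg hi
    have : -|hi| ≤ q * (-a) := by nlinarith
    nlinarith
  have e7 : q * (γ ^ 2 / 4) ≤ γ ^ 2 / 4 := by nlinarith [sq_nonneg γ]
  nlinarith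

theorem aux_norm_s13 (d : ℕ) (hd : 1 ≤ d) (x : E d) (hx : x ∈ simplexSet d) (u : E d)
    (hu : ∀ i, u i = 1 / (d : ℝ)) : ‖x - u‖ ^ 2 = ‖x‖ ^ 2 - ‖u‖ ^ 2 := by
  have hd0 : (d : ℝ) ≠ 0 := by positivity
  simp only [EuclideanSpace.norm_sq_eq, Real.norm_eq_abs, sq_abs, PiLp.sub_apply, hu, sub_sq,
    Finset.sum_add_distrib, Finset.sum_sub_distrib]
  rw [← Finset.sum_mul, ← Finset.mul_sum, hx.2]
  simp
  field_simp
  ring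

/-- with radius `r(q) = C·r_base(q)`, any minimizers `(x_C, a_C)` of `J_C`
over `Δ × I` satisfy `x_C → (1/d, …, 1/d)` as `C → ∞`. -/
theorem stmt13 (d : ℕ) (hd : 1 ≤ d)
    (γ : ℝ) (hγ : 0 < γ) (μN μS : E d) (SigN SigS : Matrix (Fin d) (Fin d) ℝ)
    (hSymN : SigN.IsSymm) (hPDN : SigN.PosDef) (hSymS : SigS.IsSymm) (hPDS : SigS.PosDef)
    (q₀ ε : ℝ) (hε : 0 ≤ ε) (hq1 : 0 < q₀ - ε) (hq2 : q₀ + ε < 1)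
    (lo hi : ℝ) (hIo : lo ≤ hi)
    (rbase : ℝ → ℝ) (hrb : ContinuousOn rbase (Set.Icc 0 1))
    (hrbnn : ∀ q ∈ Set.Icc (0 : ℝ) 1, 0 ≤ rbase q)
    (hrbne : ∃ q ∈ Set.Icc (q₀ - ε) (q₀ + ε), 0 < rbase q)
    (xC : ℝ → E d) (aC : ℝ → ℝ)
    (hmin : ∀ C : ℝ, 0 < C →
      xC C ∈ simplexSet d ∧ aC C ∈ Set.Icc lo hi ∧
        ∀ y ∈ simplexSet d, ∀ b ∈ Set.Icc lo hi,
          Jfn d SigN SigS μN μS γ (fun q => C * rbase q) q₀ ε (xC C) (aC C)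
            ≤ Jfn d SigN SigS μN μS γ (fun q => C * rbase q) q₀ ε y b) :
    Filter.Tendsto xC Filter.atTop
      (nhds ((EuclideanSpace.equiv (Fin d) ℝ).symm (fun _ => 1 / (d : ℝ)))) := by
  set u : E d := (EuclideanSpace.equiv (Fin d) ℝ).symm (fun _ => 1 / (d : ℝ)) with hudef
  have hu : ∀ i, u i = 1 / (d : ℝ) := fun i => rfl
  have hd0 : (d : ℝ) ≠ 0 := by positivity
  have huS : u ∈ simplexSet d := by
    refine ⟨fun i => ?_, ?_⟩
    · rw [hu]; positivity
    · simp only [hu]; simp [hd0]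
  have hsub : Set.Icc (q₀ - ε) (q₀ + ε) ⊆ Set.Icc (0 : ℝ) 1 :=
    Set.Icc_subset_Icc hq1.le hq2.le
  have hrK := hrb.mono hsub
  obtain ⟨qb, hqb, hrpos⟩ := hrbne
  obtain ⟨qs, hqs, hqsmax⟩ := isCompact_Icc.exists_isMaxOn ⟨qb, hqb⟩
    (continuousOn_id.mul (hrK.pow 2))
  obtain ⟨qr, hqr, hqrmax⟩ := isCompact_Icc.exists_isMaxOn ⟨qb, hqb⟩ hrK
  have hmaxA : ∀ q ∈ Set.Icc (q₀ - ε) (q₀ + ε), q * rbase q ^ 2 ≤ qs * rbase qs ^ 2 :=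
    fun q hq => hqsmax hq
  have hmaxR : ∀ q ∈ Set.Icc (q₀ - ε) (q₀ + ε), rbase q ≤ rbase qr :=
    fun q hq => hqrmax hq
  set A := qs * rbase qs ^ 2 with hAdef
  have hA : 0 < A := by
    have h1 := hmaxA qb hqb
    have h2 : 0 < qb := lt_of_lt_of_le hq1 hqb.1
    have : 0 < qb * rbase qb ^ 2 := by positivity
    linarith
  set B2 := 2 * rbase qr * ‖u‖ * Sfn d SigS μS γ u lo with hB2
  set B3 := |eNfn d SigN μN γ u lo| + Sfn d SigS μS γ u lo ^ 2 + |lo| * γ with hB3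
  set B1 := γ * ∑ i, |μN i| + |hi| * γ + γ ^ 2 / 4 with hB1
  have hup : ∀ C : ℝ, 0 < C → ∀ q ∈ Set.Icc (q₀ - ε) (q₀ + ε), ∀ x : E d, ∀ a : ℝ,
      hfn d SigN SigS μN μS γ (fun q => C * rbase q) q x a ≤
      A * C ^ 2 * ‖x‖ ^ 2 + C * (2 * rbase qr * ‖x‖ * Sfn d SigS μS γ x a)
        + (|eNfn d SigN μN γ x a| + Sfn d SigS μS γ x a ^ 2 + |a| * γ) := by
    intro C hC q hq x a
    exact aux_upper d γ hγ μN μS SigN SigS rbase A (rbase qr) C q hC (hsub hq).1 (hsub hq).2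
      (hrbnn q (hsub hq)) (hmaxR q hq) (hmaxA q hq) x a
  have key : ∀ C : ℝ, 0 < C → ‖xC C - u‖ ^ 2 ≤ (B2 * C⁻¹ + (B3 + B1) * (C⁻¹ * C⁻¹)) / A := by
    intro C hC
    obtain ⟨hx, ha, hm⟩ := hmin C hC
    have h1 := hm u huS lo ⟨le_rfl, hIo⟩
    have h2 : Jfn d SigN SigS μN μS γ (fun q => C * rbase q) q₀ ε u lo ≤
        A * C ^ 2 * ‖u‖ ^ 2 + C * B2 + B3 := by
      apply csSup_le ((Set.nonempty_of_mem hqb).image _)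
      rintro _ ⟨q, hq, rfl⟩
      exact hup C hC q hq u lo
    have h3 : A * C ^ 2 * ‖xC C‖ ^ 2 - B1 ≤
        Jfn d SigN SigS μN μS γ (fun q => C * rbase q) q₀ ε (xC C) (aC C) := by
      refine le_trans (aux_lower d γ hγ μN μS SigN SigS hPDN rbase C qs hi hC (hsub hqs).1
        (hsub hqs).2 (hrbnn qs (hsub hqs)) (xC C) hx (aC C) ha.2) ?_
      apply le_csSup
      · refine ⟨A * C ^ 2 * ‖xC C‖ ^ 2 + C * (2 * rbase qr * ‖xC C‖ * Sfn d SigS μS γ (xC C) (aC C))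
          + (|eNfn d SigN μN γ (xC C) (aC C)| + Sfn d SigS μS γ (xC C) (aC C) ^ 2
            + |aC C| * γ), ?_⟩
        rintro _ ⟨q, hq, rfl⟩
        exact hup C hC q hq (xC C) (aC C)
      · exact ⟨qs, hqs, rfl⟩
    rw [aux_norm_s13 d hd (xC C) hx u hu, le_div_iff₀ hA]
    have h4 : (‖xC C‖ ^ 2 - ‖u‖ ^ 2) * A * C ^ 2 ≤ C * B2 + (B3 + B1) := by nlinarith
    have h5 : B2 * C⁻¹ + (B3 + B1) * (C⁻¹ * C⁻¹) = (C * B2 + (B3 + B1)) / C ^ 2 := by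
      field_simp
    rw [h5, le_div_iff₀ (by positivity)]
    exact h4
  have hlim : Filter.Tendsto (fun C : ℝ => (B2 * C⁻¹ + (B3 + B1) * (C⁻¹ * C⁻¹)) / A)
      Filter.atTop (nhds 0) := by
    have hi0 : Filter.Tendsto (fun C : ℝ => C⁻¹) Filter.atTop (nhds 0) := tendsto_inv_atTop_zero
    have := ((hi0.const_mul B2).add ((hi0.mul hi0).const_mul (B3 + B1))).div_const A
    simpa using this
  have hsq : Filter.Tendsto (fun C : ℝ => ‖xC C - u‖ ^ 2) Filter.atTop (nhds 0) := by
    refine squeeze_zero' (Filter.Eventually.of_forall fun C => by positivity) ?_ hlim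
    filter_upwards [Filter.eventually_gt_atTop 0] with C hC using key C hC
  rw [tendsto_iff_norm_sub_tendsto_zero]
  have := hsq.sqrt
  simpa [Real.sqrt_sq] using this
end
end

section
/- Let (x̂,τ̂) ∈ Δ × I, let q* ∈ [q₀−ε, q₀+ε] attain the maximum defining J(x̂,τ̂), and let g_∞ ∈ ℝ^d satisfy ‖z‖_∞ ≥ ‖x̂‖_∞ + ⟨g_∞, z − x̂⟩ for all z ∈ ℝ^d (i.e., g_∞ is a subgradient of ‖·‖_∞ at x̂). Define g_x = −(1−q*)·( ∫R dP_N(R) + (ρ/(1−p))·∫R·1{−x̂ᵀR > τ̂} dP_N(R) ) + q*·( −( ∫R dP_{S₀}(R) + (ρ/(1−p))·∫R·1{−x̂ᵀR > τ̂} dP_{S₀}(R) ) + r(q*)·(1+ρ/(1−p))·g_∞ ) ∈ ℝ^d and g_τ = ρ − (1−q*)·(ρ/(1−p))·P_N({R : −x̂ᵀR > τ̂}) − q*·(ρ/(1−p))·P_{S₀}({R : −x̂ᵀR > τ̂}) ∈ ℝ. Then for every (y,s) ∈ Δ × I, J(y,s) ≥ J(x̂,τ̂) + ⟨g_x, y −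 x̂⟩ + g_τ·(s − τ̂). -/
open Matrix MeasureTheory

noncomputable section

/-- the `ℓ¹` norm `‖x‖₁ = ∑ᵢ |xᵢ|`. -/
def l1norm (d : ℕ) (x : E d) : ℝ := ∑ i, |x i|

/-- the `ℓ∞` norm `‖x‖_∞ = maxᵢ |xᵢ|`. -/
def linfnorm (d : ℕ) (x : E d) : ℝ := ⨆ i, |x i|

/-- `ℓ_{x,τ}(R) = −xᵀR + (ρ/(1−p))·max(−xᵀR − τ, 0)`. -/
def lossFn (d : ℕ) (ρ p : ℝ) (x : E d) (τ : ℝ) (R : E d) : ℝ :=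
  -(x ⬝ᵥ R) + ρ / (1 - p) * max (-(x ⬝ᵥ R) - τ) 0

/-- the inner objective
`φ(q,x,τ) = (1−q)·∫ℓ dP_N + q·(∫ℓ dP_{S₀} + r(q)(1+ρ/(1−p))‖x‖_∞)`. -/
def phiFn (d : ℕ) (ρ p : ℝ) (r : ℝ → ℝ) (PN PS : Measure (E d)) (q : ℝ)
    (x : E d) (τ : ℝ) : ℝ :=
  (1 - q) * ∫ R, lossFn d ρ p x τ R ∂PN
    + q * ((∫ R, lossFn d ρ p x τ R ∂PS) + r q * (1 + ρ / (1 - p)) * linfnorm d x)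

/-- `J(x,τ) = ρτ + max_{q ∈ [q₀−ε, q₀+ε]} φ(q,x,τ)`. -/
def Jcvar (d : ℕ) (ρ p q₀ ε : ℝ) (r : ℝ → ℝ) (PN PS : Measure (E d))
    (x : E d) (τ : ℝ) : ℝ :=
  ρ * τ + sSup ((fun q => phiFn d ρ p r PN PS q x τ) '' Set.Icc (q₀ - ε) (q₀ + ε))

lemma dot_eq_inner {d : ℕ} (x w : E d) : (x ⬝ᵥ w : ℝ) = inner ℝ x w := by
  simp [PiLp.inner_apply, dotProduct, mul_comm]

lemma meas_A {d : ℕ} (x : E d) (t : ℝ) : MeasurableSet {w : E d | -(x ⬝ᵥ w) > t} := by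
  simp only [dot_eq_inner]
  exact (isOpen_lt continuous_const (by fun_prop)).measurableSet

lemma int_loss {d : ℕ} (ρ p : ℝ) (P : Measure (E d)) [IsProbabilityMeasure P]
    (hP : Integrable (fun R : E d => R) P) (x : E d) (t : ℝ) :
    Integrable (lossFn d ρ p x t) P := by
  have h1 : Integrable (fun R : E d => (inner ℝ x R : ℝ)) P := hP.const_inner x
  unfold lossFn
  simp only [dot_eq_inner]
  exact h1.neg.add (((h1.neg.sub (integrable_const t)).pos_part).const_mul _)

lemma loss_ineq {d : ℕ} (ρ p : ℝ) (hk : 0 ≤ ρ / (1 - p)) (P : Measure (E d))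
    [IsProbabilityMeasure P]
    (hP : Integrable (fun R : E d => ‖R‖) P) (x y : E d) (t s : ℝ) :
    (∫ R, lossFn d ρ p x t R ∂P) - inner ℝ ((∫ R, R ∂P)
        + (ρ / (1 - p)) • (∫ R in {w : E d | -(x ⬝ᵥ w) > t}, R ∂P)) (y - x)
      - (ρ / (1 - p)) * (P {w : E d | -(x ⬝ᵥ w) > t}).toReal * (s - t)
      ≤ ∫ R, lossFn d ρ p y s R ∂P := by
  have hR : Integrable (fun R : E d => R) P :=
    (integrable_norm_iff aestronglyMeasurable_id).1 hP
  set A := {w : E d | -(x ⬝ᵥ w) > t} with hA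
  have mA : MeasurableSet A := meas_A x t
  set k := ρ / (1 - p) with hkd
  have hi : Integrable (fun R : E d => (inner ℝ (y - x) R : ℝ)) P := hR.const_inner _
  have hi2 : Integrable (fun R : E d => (inner ℝ (y - x) R : ℝ) + (s - t)) P :=
    hi.add (integrable_const _)
  have hx := int_loss ρ p P hR x t
  have hy := int_loss ρ p P hR y s
  have hB : Integrable (fun R => lossFn d ρ p x t R - inner ℝ (y - x) R
      - k * A.indicator (fun R => (inner ℝ (y - x) R : ℝ) + (s - t)) R) P :=
    (hx.sub hi).sub ((hi2.indicator mA).const_mul k)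
  have hle : (∫ R, (lossFn d ρ p x t R - inner ℝ (y - x) R
      - k * A.indicator (fun R => (inner ℝ (y - x) R : ℝ) + (s - t)) R) ∂P)
      ≤ ∫ R, lossFn d ρ p y s R ∂P := by
    refine integral_mono hB hy fun R => ?_
    have key : max (-(inner ℝ x R) - t) 0
        - A.indicator (fun R => (inner ℝ (y - x) R : ℝ) + (s - t)) R
        ≤ max (-(inner ℝ y R) - s) 0 := by
      by_cases h : R ∈ A
      · have h' : -(inner ℝ x R) > t := by
          have := h
          rw [hA, Set.mem_ofPred_eq, dot_eq_inner] at this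
          exact this
        rw [Set.indicator_of_mem h, inner_sub_left, max_eq_left (by linarith)]
        exact le_trans (by linarith) (le_max_left _ _)
      · have h' : -(inner ℝ x R) ≤ t := by
          have := h
          rw [hA, Set.mem_ofPred_eq, dot_eq_inner] at this
          exact not_lt.1 this
        rw [Set.indicator_of_notMem h, max_eq_right (by linarith)]
        exact le_trans (by linarith) (le_max_right _ _)
    have := mul_le_mul_of_nonneg_left key hk
    simp only [lossFn, dot_eq_inner, ← hkd]
    have e : (inner ℝ (y - x) R : ℝ) = inner ℝ y R - inner ℝ x R := inner_sub_left _ _ _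
    rw [e]
    linarith
  refine le_trans (le_of_eq ?_) hle
  have hxi : Integrable (fun R => lossFn d ρ p x t R - (inner ℝ (y - x) R : ℝ)) P := hx.sub hi
  rw [integral_sub hxi ((hi2.indicator mA).const_mul k), integral_sub hx hi,
    integral_const_mul, integral_indicator mA, integral_add hi.integrableOn (integrable_const _),
    integral_inner hR, integral_inner hR.integrableOn, inner_add_left, real_inner_smul_left,
    real_inner_comm (y - x), real_inner_comm (y - x)]
  simp [Measure.real]
  ring

/-- the explicit vector `(g_x, g_τ)` built from a maximizer `q*` of the
inner problem and a subgradient `g_∞` of `‖·‖_∞` at `x̂` is a subgradient of `J` at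
`(x̂,τ̂)` on `Δ × I`. -/
theorem stmt17 (d : ℕ) (hd : 1 ≤ d) (ρ p : ℝ) (hρ : 0 < ρ) (hp : p ∈ Set.Ioo (0 : ℝ) 1)
    (q₀ ε : ℝ) (hε : 0 ≤ ε) (hq1 : 0 < q₀ - ε) (hq2 : q₀ + ε < 1)
    (r : ℝ → ℝ) (hr : Continuous r) (hrnn : ∀ q, 0 ≤ r q)
    (lo hi : ℝ) (hIo : lo ≤ hi)
    (PN PS : Measure (E d)) [IsProbabilityMeasure PN] [IsProbabilityMeasure PS]
    (hPN : Integrable (fun R : E d => ‖R‖) PN)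
    (hPS : Integrable (fun R : E d => ‖R‖) PS)
    (xh : E d) (τh : ℝ) (hxh : xh ∈ simplexSet d) (hτh : τh ∈ Set.Icc lo hi)
    (qs : ℝ) (hqsmem : qs ∈ Set.Icc (q₀ - ε) (q₀ + ε))
    (hqsmax : ∀ q ∈ Set.Icc (q₀ - ε) (q₀ + ε),
      phiFn d ρ p r PN PS q xh τh ≤ phiFn d ρ p r PN PS qs xh τh)
    (ginf : E d)
    (hginf : ∀ z : E d, linfnorm d xh + ginf ⬝ᵥ (z - xh) ≤ linfnorm d z)
    (gx : E d)
    (hgx : gx = (-(1 - qs)) • ((∫ R, R ∂PN)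
          + (ρ / (1 - p)) • (∫ R in {w : E d | -(xh ⬝ᵥ w) > τh}, R ∂PN))
        + qs • ((-1 : ℝ) • ((∫ R, R ∂PS)
            + (ρ / (1 - p)) • (∫ R in {w : E d | -(xh ⬝ᵥ w) > τh}, R ∂PS))
          + (r qs * (1 + ρ / (1 - p))) • ginf))
    (gτ : ℝ)
    (hgτ : gτ = ρ - (1 - qs) * (ρ / (1 - p)) * (PN {w : E d | -(xh ⬝ᵥ w) > τh}).toReal
        - qs * (ρ / (1 - p)) * (PS {w : E d | -(xh ⬝ᵥ w) > τh}).toReal) :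
    ∀ y ∈ simplexSet d, ∀ s ∈ Set.Icc lo hi,
      Jcvar d ρ p q₀ ε r PN PS y s
        ≥ Jcvar d ρ p q₀ ε r PN PS xh τh + gx ⬝ᵥ (y - xh) + gτ * (s - τh) := by
  intro y hy s hs
  have hk : 0 ≤ ρ / (1 - p) := div_nonneg hρ.le (by linarith [hp.2])
  have hN := loss_ineq ρ p hk PN hPN xh y τh s
  have hS := loss_ineq ρ p hk PS hPS xh y τh s
  have hJ : sSup ((fun q => phiFn d ρ p r PN PS q xh τh) '' Set.Icc (q₀ - ε) (q₀ + ε))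
      ≤ phiFn d ρ p r PN PS qs xh τh := by
    refine csSup_le ⟨_, qs, hqsmem, rfl⟩ ?_
    rintro _ ⟨q, hq, rfl⟩
    exact hqsmax q hq
  have hJy : phiFn d ρ p r PN PS qs y s
      ≤ sSup ((fun q => phiFn d ρ p r PN PS q y s) '' Set.Icc (q₀ - ε) (q₀ + ε)) := by
    refine le_csSup ?_ ⟨qs, hqsmem, rfl⟩
    refine (isCompact_Icc.image ?_).bddAbove
    unfold phiFn
    fun_prop
  have hg : linfnorm d xh + inner ℝ ginf (y - xh) ≤ linfnorm d y := by
    rw [← dot_eq_inner]; exact hginf y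
  have hdot : gx ⬝ᵥ (y - xh) = inner ℝ gx (y - xh) := dot_eq_inner gx (y - xh)
  have q0 : 0 ≤ qs := by linarith [hqsmem.1]
  have q1 : 0 ≤ 1 - qs := by linarith [hqsmem.2]
  have c0 : 0 ≤ qs * (r qs * (1 + ρ / (1 - p))) :=
    mul_nonneg q0 (mul_nonneg (hrnn qs) (by linarith))
  have a1 := mul_le_mul_of_nonneg_left hN q1
  have a2 := mul_le_mul_of_nonneg_left hS q0
  have a3 := mul_le_mul_of_nonneg_left hg c0
  unfold Jcvar
  rw [hdot, hgx, hgτ]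
  simp only [inner_add_left, real_inner_smul_left] at a1 a2 a3 ⊢
  have main : phiFn d ρ p r PN PS qs y s - phiFn d ρ p r PN PS qs xh τh =
    phiFn d ρ p r PN PS qs y s - phiFn d ρ p r PN PS qs xh τh := rfl
  conv_rhs at main => unfold phiFn
  linarith
end
end

section
/- Let r_base : ℝ → ℝ be continuous and nonnegative on [0,1], and suppose there exists q̄ ∈ [q₀−ε, q₀+ε] with r_base(q̄) > 0. For each C > 0, let J_C(x,τ) = ρτ + max_{q ∈ [q₀−ε, q₀+ε]} [ (1−q)·∫ℓ_{x,τ} dP_N + q·( ∫ℓ_{x,τ} dP_{S₀} + C·r_base(q)·(1+ρ/(1−p))·‖x‖_∞ ) ], and let (x_C, τ_C) ∈ Δ × I be a minimizer of J_C over Δ × I. Then x_C converges to the equal-weighted vector (1/d, …, 1/d) as C → ∞. -/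
open Matrix MeasureTheory

noncomputable section

lemma aux_dot (d : ℕ) (x : E d) (hx : x ∈ simplexSet d) (R : E d) : |x ⬝ᵥ R| ≤ ‖R‖ := by
  have h1 : |x ⬝ᵥ R| ≤ ∑ i, |x i * R i| := by
    unfold dotProduct
    exact Finset.abs_sum_le_sum_abs _ _
  have h2 : ∑ i, |x i * R i| ≤ ∑ i, x i * ‖R‖ := by
    apply Finset.sum_le_sum
    intro i _
    rw [abs_mul, abs_of_nonneg (hx.1 i)]
    exact mul_le_mul_of_nonneg_left (PiLp.norm_apply_le R i) (hx.1 i)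
  rw [← Finset.sum_mul, hx.2, one_mul] at h2
  exact h1.trans h2

lemma aux_int (d : ℕ) (ρ p : ℝ) (hk : 0 ≤ ρ / (1 - p)) (T : ℝ)
    (P : Measure (E d)) [IsProbabilityMeasure P] (hP : Integrable (fun R : E d => ‖R‖) P)
    (x : E d) (hx : x ∈ simplexSet d) (τ : ℝ) (hτ : |τ| ≤ T) :
    |∫ R, lossFn d ρ p x τ R ∂P| ≤ ∫ R, (‖R‖ + ρ / (1 - p) * (‖R‖ + T)) ∂P := by
  rw [← Real.norm_eq_abs]
  apply norm_integral_le_of_norm_le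
  · exact hP.add ((hP.add (integrable_const T)).const_mul _)
  · refine Filter.Eventually.of_forall fun R => ?_
    have h := aux_dot d x hx R
    rw [Real.norm_eq_abs]
    unfold lossFn
    have hm : |max (-(x ⬝ᵥ R) - τ) 0| ≤ ‖R‖ + T := by
      rw [abs_of_nonneg (le_max_right _ _)]
      have := abs_le.1 h
      have := abs_le.1 hτ
      apply max_le <;> linarith [norm_nonneg R]
    refine (abs_add_le _ _).trans ?_
    rw [abs_neg, abs_mul, abs_of_nonneg hk]
    gcongr

lemma aux_linf (d : ℕ) (x : E d) (i : Fin d) : |x i| ≤ linfnorm d x := by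
  unfold linfnorm
  exact le_ciSup (f := fun i => |x i|) (Set.finite_range _).bddAbove i

lemma aux_coord (d : ℕ) (hd : 1 ≤ d) (x : E d) (hx : x ∈ simplexSet d) (δ : ℝ)
    (h : linfnorm d x ≤ 1 / d + δ) (i : Fin d) : |x i - 1 / d| ≤ d * δ := by
  have hd' : (1 : ℝ) ≤ d := by exact_mod_cast hd
  have hle : ∀ j, x j ≤ 1 / d + δ := fun j => (le_abs_self _).trans ((aux_linf d x j).trans h)
  have hsum : ∑ j, (1 / d + δ - x j) = d * δ := by
    rw [Finset.sum_sub_distrib, hx.2]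
    simp
    field_simp
    ring
  have h1 : 1 / d + δ - x i ≤ ∑ j, (1 / d + δ - x j) :=
    Finset.single_le_sum (f := fun j => 1 / (d : ℝ) + δ - x j)
      (fun j _ => by linarith [hle j]) (Finset.mem_univ i)
  have h0 : 0 ≤ d * δ := by
    rw [← hsum]
    exact Finset.sum_nonneg (fun j _ => by linarith [hle j])
  have hδ : 0 ≤ δ := by
    by_contra hc
    push Not at hc
    nlinarith
  rw [abs_le]
  constructor
  · linarith
  · have := hle i
    nlinarith

/-- with radius `C·r_base(q)`, any minimizers `(x_C, τ_C)` of `J_C` over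
`Δ × I` satisfy `x_C → (1/d, …, 1/d)` as `C → ∞`. -/
theorem stmt19 (d : ℕ) (hd : 1 ≤ d) (ρ p : ℝ) (hρ : 0 < ρ) (hp : p ∈ Set.Ioo (0 : ℝ) 1)
    (q₀ ε : ℝ) (hε : 0 ≤ ε) (hq1 : 0 < q₀ - ε) (hq2 : q₀ + ε < 1)
    (lo hi : ℝ) (hIo : lo ≤ hi)
    (PN PS : Measure (E d)) [IsProbabilityMeasure PN] [IsProbabilityMeasure PS]
    (hPN : Integrable (fun R : E d => ‖R‖) PN)
    (hPS : Integrable (fun R : E d => ‖R‖) PS)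
    (rbase : ℝ → ℝ) (hrb : ContinuousOn rbase (Set.Icc 0 1))
    (hrbnn : ∀ q ∈ Set.Icc (0 : ℝ) 1, 0 ≤ rbase q)
    (hrbne : ∃ q ∈ Set.Icc (q₀ - ε) (q₀ + ε), 0 < rbase q)
    (xC : ℝ → E d) (τC : ℝ → ℝ)
    (hmin : ∀ C : ℝ, 0 < C →
      xC C ∈ simplexSet d ∧ τC C ∈ Set.Icc lo hi ∧
        ∀ y ∈ simplexSet d, ∀ s ∈ Set.Icc lo hi,
          Jcvar d ρ p q₀ ε (fun q => C * rbase q) PN PS (xC C) (τC C)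
            ≤ Jcvar d ρ p q₀ ε (fun q => C * rbase q) PN PS y s) :
    Filter.Tendsto xC Filter.atTop
      (nhds ((EuclideanSpace.equiv (Fin d) ℝ).symm (fun _ => 1 / (d : ℝ)))) := by
  obtain ⟨hp0, hp1⟩ := hp
  have hk : 0 < ρ / (1 - p) := div_pos hρ (by linarith)
  set κ := 1 + ρ / (1 - p) with hκ
  have hκ0 : 0 < κ := by linarith
  set T := max |lo| |hi| with hT
  have hτT : ∀ t ∈ Set.Icc lo hi, |t| ≤ T := fun t ht => abs_le_max_abs_abs ht.1 ht.2
  set BN := ∫ R, (‖R‖ + ρ / (1 - p) * (‖R‖ + T)) ∂PN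
  set BS := ∫ R, (‖R‖ + ρ / (1 - p) * (‖R‖ + T)) ∂PS
  set B := max BN BS with hB
  have hIN : ∀ x ∈ simplexSet d, ∀ t ∈ Set.Icc lo hi, |∫ R, lossFn d ρ p x t R ∂PN| ≤ B :=
    fun x hx t ht => (aux_int d ρ p hk.le T PN hPN x hx t (hτT t ht)).trans (le_max_left _ _)
  have hIS : ∀ x ∈ simplexSet d, ∀ t ∈ Set.Icc lo hi, |∫ R, lossFn d ρ p x t R ∂PS| ≤ B :=
    fun x hx t ht => (aux_int d ρ p hk.le T PS hPS x hx t (hτT t ht)).trans (le_max_right _ _)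
  have hsub : Set.Icc (q₀ - ε) (q₀ + ε) ⊆ Set.Icc 0 1 :=
    Set.Icc_subset_Icc hq1.le hq2.le
  obtain ⟨q1, hq1m, hq1r⟩ := hrbne
  obtain ⟨qs, hqs, hqmax⟩ := (isCompact_Icc (a := q₀ - ε) (b := q₀ + ε)).exists_isMaxOn
    ⟨q1, hq1m⟩ (f := fun q => q * rbase q) (continuousOn_id.mul (hrb.mono hsub))
  set G := qs * rbase qs with hG
  have hGmax : ∀ q ∈ Set.Icc (q₀ - ε) (q₀ + ε), q * rbase q ≤ G := fun q hq => hqmax hq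
  have hG0 : 0 < G :=
    lt_of_lt_of_le (mul_pos (by linarith [hq1m.1]) hq1r) (hGmax q1 hq1m)
  have : Nonempty (Fin d) := ⟨⟨0, hd⟩⟩
  have hM0 : ∀ x : E d, 0 ≤ linfnorm d x := fun x =>
    (abs_nonneg _).trans (aux_linf d x ⟨0, hd⟩)
  have hphi : ∀ C, 0 < C → ∀ x ∈ simplexSet d, ∀ t ∈ Set.Icc lo hi,
      ∀ q ∈ Set.Icc (q₀ - ε) (q₀ + ε),
      |phiFn d ρ p (fun q => C * rbase q) PN PS q x t - C * (q * rbase q) * κ * linfnorm d x|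
        ≤ B := by
    intro C hC x hx t ht q hq
    have a := abs_le.1 (hIN x hx t ht)
    have b := abs_le.1 (hIS x hx t ht)
    have hq' := hsub hq
    have e : phiFn d ρ p (fun q => C * rbase q) PN PS q x t - C * (q * rbase q) * κ * linfnorm d x
      = (1 - q) * ∫ R, lossFn d ρ p x t R ∂PN + q * ∫ R, lossFn d ρ p x t R ∂PS := by
      unfold phiFn
      ring
    rw [e, abs_le]
    have := hq'.1
    have : 0 ≤ 1 - q := by linarith [hq'.2]
    constructor <;> nlinarith
  have hub : ∀ C, 0 < C → ∀ x ∈ simplexSet d, ∀ t ∈ Set.Icc lo hi,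
      ∀ q ∈ Set.Icc (q₀ - ε) (q₀ + ε),
      phiFn d ρ p (fun q => C * rbase q) PN PS q x t ≤ B + C * G * κ * linfnorm d x := by
    intro C hC x hx t ht q hq
    have h1 := (abs_le.1 (hphi C hC x hx t ht q hq)).2
    have h2 : C * (q * rbase q) * κ * linfnorm d x ≤ C * G * κ * linfnorm d x := by
      have := hGmax q hq
      have := hM0 x
      gcongr
    linarith
  set u : E d := (EuclideanSpace.equiv (Fin d) ℝ).symm (fun _ => 1 / (d : ℝ)) with hu
  have hdpos : (0 : ℝ) < d := by exact_mod_cast hd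
  have hui : ∀ i, u i = 1 / (d : ℝ) := fun i => rfl
  have hus : u ∈ simplexSet d := by
    refine ⟨fun i => by rw [hui]; positivity, ?_⟩
    simp only [hui]
    simp
    field_simp
  have hul : linfnorm d u = 1 / d := by
    unfold linfnorm
    simp only [hui, ciSup_const]
    exact abs_of_nonneg (by positivity)
  have hlo : lo ∈ Set.Icc lo hi := ⟨le_rfl, hIo⟩
  set K := (2 * B + 2 * ρ * T) / (G * κ) with hK
  have hkey : ∀ C, 0 < C → linfnorm d (xC C) ≤ 1 / d + K / C := by
    intro C hC
    obtain ⟨hx, ht, hm⟩ := hmin C hC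
    have h := hm u hus lo hlo
    unfold Jcvar at h
    have hupper : sSup ((fun q => phiFn d ρ p (fun q => C * rbase q) PN PS q u lo) ''
        Set.Icc (q₀ - ε) (q₀ + ε)) ≤ B + C * G * κ * (1 / d) := by
      apply csSup_le ⟨_, Set.mem_image_of_mem _ hqs⟩
      rintro _ ⟨q, hq, rfl⟩
      have := hub C hC u hus lo hlo q hq
      rwa [hul] at this
    have hlower : -B + C * G * κ * linfnorm d (xC C) ≤
        sSup ((fun q => phiFn d ρ p (fun q => C * rbase q) PN PS q (xC C) (τC C)) ''
        Set.Icc (q₀ - ε) (q₀ + ε)) := by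
      have h1 := (abs_le.1 (hphi C hC _ hx _ ht qs hqs)).1
      refine le_trans ?_ (le_csSup ?_ (Set.mem_image_of_mem _ hqs))
      · show _ ≤ phiFn d ρ p (fun q => C * rbase q) PN PS qs (xC C) (τC C)
        linarith
      · refine ⟨B + C * G * κ * linfnorm d (xC C), ?_⟩
        rintro _ ⟨q, hq, rfl⟩
        exact hub C hC _ hx _ ht q hq
    have t1 : ρ * lo ≤ ρ * T :=
      mul_le_mul_of_nonneg_left (abs_le.1 (hτT lo hlo)).2 hρ.le
    have t2 : ρ * (-T) ≤ ρ * τC C :=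
      mul_le_mul_of_nonneg_left (abs_le.1 (hτT _ ht)).1 hρ.le
    have h3 : (linfnorm d (xC C) - 1 / d) * (G * κ * C) ≤ 2 * B + 2 * ρ * T := by
      linarith
    have h4 : linfnorm d (xC C) - 1 / d ≤ K / C := by
      rw [hK, div_div, le_div_iff₀ (by positivity)]
      exact h3
    linarith
  have hcoord : ∀ i, Filter.Tendsto (fun C => xC C i) Filter.atTop (nhds (1 / (d : ℝ))) := by
    intro i
    rw [tendsto_iff_norm_sub_tendsto_zero]
    have hlim : Filter.Tendsto (fun C : ℝ => d * (K / C)) Filter.atTop (nhds 0) := by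
      have := (tendsto_const_nhds (x := K)).div_atTop (Filter.tendsto_id (α := ℝ))
      simpa using this.const_mul (d : ℝ)
    refine squeeze_zero' (Filter.Eventually.of_forall fun _ => norm_nonneg _) ?_ hlim
    filter_upwards [Filter.eventually_gt_atTop 0] with C hC
    exact aux_coord d hd _ (hmin C hC).1 _ (hkey C hC) i
  have hpi : Filter.Tendsto (fun C => (EuclideanSpace.equiv (Fin d) ℝ) (xC C)) Filter.atTop
      (nhds (fun _ => 1 / (d : ℝ))) := tendsto_pi_nhds.2 hcoord
  have := ((EuclideanSpace.equiv (Fin d) ℝ).symm.continuous.tendsto _).comp hpi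
  exact this
end
end
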